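/- In the discharging of H defined by rules R1–R5 applied to the initial charge (every j-face charged with weight j), every minor 3-face f of H has final weight w(f) ≥ 10/3. -/

import Mathlib

open scoped Classical

noncomputable section

/-- A plane embedding (drawing) of a simple graph: vertices are mapped to distinct
points of the plane, every edge is drawn as a simple arc joining the points of its two
endvertices, arcs contain no vertex points other than their endpoints, and two distinct
arcs meet only in common endpoints. -/
structure PlaneEmbedding {V : Type*} (G : SimpleGraph V) where
  pos : V → ℝ × ℝ
  arc : V → V → Set (ℝ × ℝ)
  pos_injective : Function.Injective pos
  arc_symm : ∀ u v, arc u v = arc v u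
  arc_curve : ∀ u v, G.Adj u v → ∃ γ : ℝ → ℝ × ℝ,
      ContinuousOn γ (Set.Icc 0 1) ∧ Set.InjOn γ (Set.Icc 0 1) ∧
      γ 0 = pos u ∧ γ 1 = pos v ∧ γ '' Set.Icc 0 1 = arc u v
  arc_vertex : ∀ u v, G.Adj u v → ∀ w, pos w ∈ arc u v → w = u ∨ w = v
  arc_inter : ∀ u v x y, G.Adj u v → G.Adj x y → s(u, v) ≠ s(x, y) →
      arc u v ∩ arc x y ⊆ Set.range pos

/-- A graph is planar if it admits a plane embedding. -/
def SimpleGraph.IsPlanar {V : Type*} (G : SimpleGraph V) : Prop :=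
  Nonempty (PlaneEmbedding G)

/-- A graph is 3-connected if it has at least four vertices and deleting any set of at
most two vertices leaves a connected graph. -/
def ThreeConnected {V : Type*} [Fintype V] (G : SimpleGraph V) : Prop :=
  4 ≤ Fintype.card V ∧
    ∀ S : Finset V, S.card ≤ 2 → (G.induce ((↑S : Set V)ᶜ)).Connected

/-- `S` is a separator of `G`: deleting it leaves a disconnected graph. -/
def IsSeparator {V : Type*} [Fintype V] (G : SimpleGraph V) (S : Finset V) : Prop :=
  ¬ (G.induce ((↑S : Set V)ᶜ)).Connected

/-- A separator `S` is trivial if some component of `G - S` is a single vertex, i.e.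
some vertex outside `S` has all of its neighbours inside `S`. -/
def TrivialSeparator {V : Type*} [Fintype V] (G : SimpleGraph V) (S : Finset V) : Prop :=
  ∃ v : V, v ∉ S ∧ ∀ w : V, G.Adj v w → w ∈ S

/-- A graph is essentially 4-connected if it is 3-connected and every 3-separator is
trivial. -/
def EssentiallyFourConnected {V : Type*} [Fintype V] (G : SimpleGraph V) : Prop :=
  ThreeConnected G ∧
    ∀ S : Finset V, S.card = 3 → IsSeparator G S → TrivialSeparator G S

/-- A cycle `C` of `G` is isolating if every component of `G - V(C)` is a single vertex
of degree 3 in `G`, i.e. every vertex not on `C` has degree 3 in `G` and all of its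
neighbours on `C`. -/
def IsIsolating {V : Type*} [Fintype V] (G : SimpleGraph V) {x : V} (C : G.Walk x x) : Prop :=
  ∀ v : V, v ∉ C.support →
    (Finset.univ.filter fun w => G.Adj v w).card = 3 ∧ ∀ w : V, G.Adj v w → w ∈ C.support

/-- `C` is a longest isolating cycle of `G`. -/
def IsLongestIsolatingCycle {V : Type*} [Fintype V] (G : SimpleGraph V) {x : V}
    (C : G.Walk x x) : Prop :=
  C.IsCycle ∧ IsIsolating G C ∧
    ∀ (y : V) (C' : G.Walk y y), C'.IsCycle → IsIsolating G C' → C'.length ≤ C.length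

section PlaneSetup

variable {V : Type*} [Fintype V] {G : SimpleGraph V}

/-- The chords of the cycle `C`: edges of `G` not on `C` joining two vertices of `C`. -/
def chordSet {x : V} (C : G.Walk x x) : Set (Sym2 V) :=
  {e | e ∈ G.edgeSet ∧ e ∉ C.edges ∧ ∀ v ∈ e, v ∈ C.support}

/-- The plane graph `H` obtained from `G` by deleting all chords of `C`. -/
def Hgraph {x : V} (C : G.Walk x x) : SimpleGraph V :=
  G.deleteEdges (chordSet C)

/-- The arc drawing an edge, as a function of the unordered edge. -/
def arcSet (emb : PlaneEmbedding G) : Sym2 V → Set (ℝ × ℝ) :=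
  Sym2.lift ⟨emb.arc, emb.arc_symm⟩

/-- The point set of the drawing of the subgraph of `H'` induced on the vertex set `s`
(in the embedding `emb` of `G`). -/
def drawingOn (emb : PlaneEmbedding G) (H' : SimpleGraph V) (s : Set V) : Set (ℝ × ℝ) :=
  emb.pos '' s ∪
    ⋃ (u : V) (v : V) (_ : H'.Adj u v) (_ : u ∈ s) (_ : v ∈ s), emb.arc u v

/-- The drawing of `H`. -/
def drawingH (emb : PlaneEmbedding G) {x : V} (C : G.Walk x x) : Set (ℝ × ℝ) :=
  drawingOn emb (Hgraph C) Set.univ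

/-- `f` is a face of the drawing `D`: a connected component of its complement. -/
def IsFaceOf (D : Set (ℝ × ℝ)) (f : Set (ℝ × ℝ)) : Prop :=
  ∃ z : ℝ × ℝ, z ∉ D ∧ f = connectedComponentIn Dᶜ z

/-- The drawing of the cycle `C`. -/
def drawC (emb : PlaneEmbedding G) {x : V} (C : G.Walk x x) : Set (ℝ × ℝ) :=
  ⋃ e ∈ C.edges, arcSet emb e

/-- The open region strictly inside the closed curve given by `C`: the points off the
curve whose connected component in the complement is bounded. -/
def insideC (emb : PlaneEmbedding G) {x : V} (C : G.Walk x x) : Set (ℝ × ℝ) :=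
  {z | z ∉ drawC emb C ∧ Bornology.IsBounded (connectedComponentIn (drawC emb C)ᶜ z)}

/-- The vertices of `G` strictly inside `C`. -/
def Vminus (emb : PlaneEmbedding G) {x : V} (C : G.Walk x x) : Finset V :=
  Finset.univ.filter fun v => v ∉ C.support ∧ emb.pos v ∈ insideC emb C

/-- The vertices of `G` strictly outside `C`:  `V⁺ = V - V(C) - V⁻`. -/
def Vplus (emb : PlaneEmbedding G) {x : V} (C : G.Walk x x) : Finset V :=
  Finset.univ.filter fun v => v ∉ C.support ∧ v ∉ Vminus emb C

/-- A face `f` is incident with the vertex `v`. -/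
def incVertex (emb : PlaneEmbedding G) (f : Set (ℝ × ℝ)) (v : V) : Prop :=
  emb.pos v ∈ closure f

/-- A face `f` is incident with the edge `e` (the arc of `e` lies on the boundary). -/
def incEdge (emb : PlaneEmbedding G) (f : Set (ℝ × ℝ)) (e : Sym2 V) : Prop :=
  arcSet emb e ⊆ closure f

/-- A minor face of the drawing `D`: a face incident with exactly one vertex of
`V⁻ ∪ V⁺`. -/
def MinorFaceOf (emb : PlaneEmbedding G) {x : V} (C : G.Walk x x)
    (D : Set (ℝ × ℝ)) (f : Set (ℝ × ℝ)) : Prop :=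
  IsFaceOf D f ∧ ∃! v : V, v ∈ Vminus emb C ∪ Vplus emb C ∧ incVertex emb f v

/-- `M⁻`: the minor faces of `H⁻ = H - V⁺`. -/
def Mminus (emb : PlaneEmbedding G) {x : V} (C : G.Walk x x) : Set (Set (ℝ × ℝ)) :=
  {f | MinorFaceOf emb C (drawingOn emb (Hgraph C) ((↑(Vplus emb C) : Set V)ᶜ)) f}

/-- `M⁺`: the minor faces of `H⁺ = H - V⁻`. -/
def Mplus (emb : PlaneEmbedding G) {x : V} (C : G.Walk x x) : Set (Set (ℝ × ℝ)) :=
  {f | MinorFaceOf emb C (drawingOn emb (Hgraph C) ((↑(Vminus emb C) : Set V)ᶜ)) f}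

/-- A minor face of `H`. -/
def MinorFaceH (emb : PlaneEmbedding G) {x : V} (C : G.Walk x x) (f : Set (ℝ × ℝ)) : Prop :=
  MinorFaceOf emb C (drawingH emb C) f

/-- A major face of `H`: a face of `H` that is not minor. -/
def MajorFaceH (emb : PlaneEmbedding G) {x : V} (C : G.Walk x x) (f : Set (ℝ × ℝ)) : Prop :=
  IsFaceOf (drawingH emb C) f ∧ ¬ MinorFaceH emb C f

/-- The number of `C`-edges of a face `f` (so `f` is a `j`-face when this equals `j`). -/
def numCEdges (emb : PlaneEmbedding G) {x : V} (C : G.Walk x x) (f : Set (ℝ × ℝ)) : ℕ :=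
  (C.edges.toFinset.filter fun e => incEdge emb f e).card

/-- `m_{f,f'}`: the number of common `C`-edges of the faces `f` and `f'`. -/
def mEdges (emb : PlaneEmbedding G) {x : V} (C : G.Walk x x)
    (f f' : Set (ℝ × ℝ)) : ℕ :=
  (C.edges.toFinset.filter fun e => incEdge emb f e ∧ incEdge emb f' e).card

/-- `f'` is opposite to `f` (with respect to some `C`-edge incident with both). -/
def OppositeFaces (emb : PlaneEmbedding G) {x : V} (C : G.Walk x x)
    (f f' : Set (ℝ × ℝ)) : Prop :=
  f ≠ f' ∧ ∃ e ∈ C.edges, incEdge emb f e ∧ incEdge emb f' e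

/-- `e` is the middle `C`-edge of the face `f` (for a 3-face, the `C`-edge sharing an
endvertex with every other `C`-edge of `f`). -/
def IsMiddleCEdge (emb : PlaneEmbedding G) {x : V} (C : G.Walk x x)
    (f : Set (ℝ × ℝ)) (e : Sym2 V) : Prop :=
  e ∈ C.edges ∧ incEdge emb f e ∧
    ∀ e' ∈ C.edges, incEdge emb f e' → e' ≠ e → ∃ v : V, v ∈ e ∧ v ∈ e'

/-- The total weight sent from the face `f` to the face `f'` by the discharging rules
R1–R5 (each rule applied exactly once). -/
def sendWeight (emb : PlaneEmbedding G) {x : V} (C : G.Walk x x)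
    (f f' : Set (ℝ × ℝ)) : ℚ :=
  -- R1: a major face sends `m_{f,f'}` to every opposite minor face
  (if MajorFaceH emb C f ∧ MinorFaceH emb C f' ∧ OppositeFaces emb C f f'
    then (mEdges emb C f f' : ℚ) else 0)
  -- R2: a minor face sends `(2/3)·m_{f,f'}` to every opposite minor 2-face
  + (if MinorFaceH emb C f ∧ MinorFaceH emb C f' ∧ numCEdges emb C f' = 2 ∧
        OppositeFaces emb C f f'
    then 2 / 3 * (mEdges emb C f f' : ℚ) else 0)
  -- R3: a minor face sends 1 to every minor 3-face opposite with respect to its middle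
  -- `C`-edge
  + (if MinorFaceH emb C f ∧ MinorFaceH emb C f' ∧ numCEdges emb C f' = 3 ∧ f ≠ f' ∧
        (∃ e : Sym2 V, IsMiddleCEdge emb C f' e ∧ incEdge emb f e)
    then 1 else 0)
  -- R4
  + (if MinorFaceH emb C f ∧ 4 ≤ numCEdges emb C f ∧ MinorFaceH emb C f' ∧
        numCEdges emb C f' = 4 ∧ OppositeFaces emb C f' f ∧ mEdges emb C f' f = 2 ∧
        (∃ f₂ : Set (ℝ × ℝ), MinorFaceH emb C f₂ ∧
          (numCEdges emb C f₂ = 2 ∨ numCEdges emb C f₂ = 3) ∧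
          OppositeFaces emb C f' f₂ ∧ mEdges emb C f' f₂ = 2)
    then 2 / 3 else 0)
  -- R5
  + (if MinorFaceH emb C f ∧ 4 ≤ numCEdges emb C f ∧ MinorFaceH emb C f' ∧
        numCEdges emb C f' = 5 ∧ OppositeFaces emb C f' f ∧ mEdges emb C f' f = 2 ∧
        (∃ g₁ g₂ : Set (ℝ × ℝ), g₁ ≠ g₂ ∧
          MinorFaceH emb C g₁ ∧ numCEdges emb C g₁ = 2 ∧ OppositeFaces emb C f' g₁ ∧
          MinorFaceH emb C g₂ ∧ numCEdges emb C g₂ = 2 ∧ OppositeFaces emb C f' g₂)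
    then 1 / 3 else 0)

/-- The final weight of a face `f` after discharging: the initial charge `j` of a
`j`-face, minus everything sent, plus everything received. -/
def wFace (emb : PlaneEmbedding G) {x : V} (C : G.Walk x x) (f : Set (ℝ × ℝ)) : ℚ :=
  (numCEdges emb C f : ℚ) - (∑ᶠ f' : Set (ℝ × ℝ), sendWeight emb C f f')
    + ∑ᶠ f' : Set (ℝ × ℝ), sendWeight emb C f' f

end PlaneSetup

section

set_option linter.unusedSectionVars false

open Set Topology

/-- A nowhere vanishing continuous function on a compact convex set has a continuous logarithm. -/
theorem exists_log_of_convex {E : Type*} [NormedAddCommGroup E] [NormedSpace ℝ E] {K : Set E}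
    (hK : IsCompact K) (hc : Convex ℝ K) {h : E → ℂ} (hh : ContinuousOn h K)
    (h0 : ∀ x ∈ K, h x ≠ 0) :
    ∃ g : E → ℂ, ContinuousOn g K ∧ ∀ x ∈ K, Complex.exp (g x) = h x := by
  rcases K.eq_empty_or_nonempty with rfl | ⟨x₀, hx₀⟩
  · exact ⟨0, by simp, by simp⟩
  obtain ⟨xm, hxm, hmin⟩ := hK.exists_isMinOn ⟨x₀, hx₀⟩ hh.norm
  have hm : 0 < ‖h xm‖ := norm_pos_iff.2 (h0 _ hxm)
  have huc := hK.uniformContinuousOn_of_continuous hh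
  rw [Metric.uniformContinuousOn_iff] at huc
  obtain ⟨δ, hδ, huc⟩ := huc _ hm
  obtain ⟨D, hD⟩ := hK.isBounded.subset_closedBall x₀
  obtain ⟨N, hN⟩ := exists_nat_gt (max 0 (D / δ))
  have hN0 : (0 : ℝ) < N := lt_of_le_of_lt (le_max_left _ _) hN
  have hND : D < N * δ := by
    have := lt_of_le_of_lt (le_max_right _ _) hN
    rwa [div_lt_iff₀ hδ] at this
  let p : ℕ → E → E := fun k x => x₀ + ((k : ℝ) / N) • (x - x₀)
  have hpK : ∀ k ≤ N, ∀ x ∈ K, p k x ∈ K := by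
    intro k hk x hx
    have : p k x = AffineMap.lineMap x₀ x ((k : ℝ) / N) := by
      simp [p, AffineMap.lineMap_apply, add_comm]
    rw [this]
    refine hc.lineMap_mem hx₀ hx ⟨by positivity, ?_⟩
    rw [div_le_one hN0]; exact_mod_cast hk
  have hpc : ∀ k, Continuous (p k) := fun k => by fun_prop
  have hratio : ∀ k < N, ∀ x ∈ K, h (p (k + 1) x) / h (p k x) ∈ Complex.slitPlane := by
    intro k hk x hx
    have hkK := hpK k hk.le x hx
    have hd : dist (p (k + 1) x) (p k x) < δ := by
      have : p (k + 1) x - p k x = ((1 : ℝ) / N) • (x - x₀) := by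
        simp only [p, add_sub_add_left_eq_sub, ← sub_smul]
        congr 1; push_cast; ring
      rw [dist_eq_norm, this, norm_smul, Real.norm_of_nonneg (by positivity)]
      have h1 : ‖x - x₀‖ ≤ D := by simpa [dist_eq_norm] using hD hx
      rw [one_div, inv_mul_lt_iff₀ hN0]
      linarith
    have h1 := huc _ (hpK (k + 1) hk x hx) _ hkK hd
    have h2 : ‖h xm‖ ≤ ‖h (p k x)‖ := hmin hkK
    have h3 : ‖h (p (k + 1) x) / h (p k x) - 1‖ < 1 := by
      rw [div_sub_one (h0 _ hkK), norm_div, div_lt_one (norm_pos_iff.2 (h0 _ hkK)), ← dist_eq_norm]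
      linarith
    refine Or.inl ?_
    have h4 := (Complex.abs_re_le_norm _).trans_lt h3
    rw [abs_lt] at h4
    simp only [Complex.sub_re, Complex.one_re] at h4
    linarith [h4.1]
  refine ⟨fun x => Complex.log (h x₀) +
    ∑ k ∈ Finset.range N, Complex.log (h (p (k + 1) x) / h (p k x)), ?_, ?_⟩
  · refine continuousOn_const.add (continuousOn_finsetSum _ fun k hk => ?_)
    have hk := Finset.mem_range.1 hk
    refine ContinuousOn.clog ?_ (hratio k hk)
    exact (hh.comp (hpc _).continuousOn (hpK _ hk)).div
      (hh.comp (hpc _).continuousOn (hpK _ hk.le)) fun x hx => h0 _ (hpK _ hk.le x hx)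
  · intro x hx
    rw [Complex.exp_add, Complex.exp_log (h0 _ hx₀), Complex.exp_sum]
    have : ∀ k ∈ Finset.range N, Complex.exp (Complex.log (h (p (k + 1) x) / h (p k x))) =
        h (p (k + 1) x) / h (p k x) := by
      intro k hk
      have hk := Finset.mem_range.1 hk
      exact Complex.exp_log (div_ne_zero (h0 _ (hpK _ hk x hx)) (h0 _ (hpK _ hk.le x hx)))
    rw [Finset.prod_congr rfl this]
    have h5 : ∀ M ≤ N, h x₀ * ∏ k ∈ Finset.range M, h (p (k + 1) x) / h (p k x) = h (p M x) := by
      intro M hM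
      induction M with
      | zero => simp [p]
      | succ M ih =>
        rw [Finset.prod_range_succ, ← mul_assoc, ih (by omega)]
        field_simp [h0 _ (hpK M (by omega) x hx)]
    rw [h5 N le_rfl]
    simp [p, hN0.ne']

/-- Continuous logarithm of the quotient `(z - a) / (z - b)` on `K`. -/
def HasQuotientLog (K : Set ℂ) (a b : ℂ) : Prop :=
  ∃ g : ℂ → ℂ, ContinuousOn g K ∧ ∀ z ∈ K, Complex.exp (g z) * (z - b) = z - a

theorem HasQuotientLog.symm {K : Set ℂ} {a b : ℂ} (h : HasQuotientLog K a b) :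
    HasQuotientLog K b a := by
  obtain ⟨g, hg, h⟩ := h
  refine ⟨fun z => - g z, hg.neg, fun z hz => ?_⟩
  rw [← h z hz, ← mul_assoc, ← Complex.exp_add]; simp

theorem HasQuotientLog.trans {K : Set ℂ} {a b c : ℂ} (h : HasQuotientLog K a b)
    (h' : HasQuotientLog K b c) : HasQuotientLog K a c := by
  obtain ⟨g, hg, h⟩ := h
  obtain ⟨g', hg', h'⟩ := h'
  refine ⟨fun z => g z + g' z, hg.add hg', fun z hz => ?_⟩
  rw [Complex.exp_add, mul_assoc, h' z hz, h z hz]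

/-- Two points in a connected subset of the complement of `K`. -/
def Unseparated {X : Type*} [TopologicalSpace X] (K : Set X) (a b : X) : Prop :=
  ∃ S, IsPreconnected S ∧ S ⊆ Kᶜ ∧ a ∈ S ∧ b ∈ S

theorem Unseparated.hasQuotientLog {K : Set ℂ} (hK : IsCompact K) {a b : ℂ}
    (h : Unseparated K a b) : HasQuotientLog K a b := by
  obtain ⟨S, hS, hSK, ha, hb⟩ := h
  refine hS.induction₂ (HasQuotientLog K) ?_ (fun _ _ _ _ _ _ h h' => h.trans h')
    (fun _ _ _ _ h => h.symm) ha hb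
  intro x hx
  obtain ⟨r, hr, hball⟩ := Metric.isOpen_iff.1 hK.isClosed.isOpen_compl x (hSK hx)
  refine nhdsWithin_le_nhds (Filter.mem_of_superset (Metric.ball_mem_nhds x hr) fun y hy => ?_)
  refine HasQuotientLog.symm ⟨fun z => Complex.log ((z - y) / (z - x)), ?_, fun z hz => ?_⟩
  · refine ContinuousOn.clog (ContinuousOn.div (by fun_prop) (by fun_prop) ?_) ?_
    · intro z hz h
      rw [sub_eq_zero.1 h] at hz
      exact hSK hx hz
    · intro z hz
      have hzx : z - x ≠ 0 := fun h => hSK hx (by rwa [sub_eq_zero.1 h] at hz)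
      have h1 : r ≤ ‖z - x‖ := by
        by_contra! hlt
        exact hball (by simpa [dist_eq_norm] using hlt) hz
      have h3 : ‖(z - y) / (z - x) - 1‖ < 1 := by
        rw [div_sub_one hzx, norm_div, div_lt_one (norm_pos_iff.2 hzx)]
        have : ‖y - x‖ < r := by simpa [dist_eq_norm] using hy
        rw [show z - y - (z - x) = -(y - x) by ring, norm_neg]
        linarith
      refine Or.inl ?_
      have h4 := (Complex.abs_re_le_norm _).trans_lt h3
      rw [abs_lt] at h4
      simp only [Complex.sub_re, Complex.one_re] at h4
      linarith [h4.1]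
  · have hzx : z - x ≠ 0 := fun h => hSK hx (by rwa [sub_eq_zero.1 h] at hz)
    have hzy : z - y ≠ 0 := fun h => hball hy (by rwa [sub_eq_zero.1 h] at hz)
    rw [Complex.exp_log (div_ne_zero hzy hzx), div_mul_cancel₀ _ hzx]

theorem exp_eq_const_of_preconnected {X : Type*} [TopologicalSpace X] {S : Set X}
    (hS : IsPreconnected S) {g : X → ℂ} (hg : ContinuousOn g S) {w : ℂ}
    (h : ∀ x ∈ S, Complex.exp (g x) = w) {x y : X} (hx : x ∈ S) (hy : y ∈ S) : g x = g y := by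
  refine hS.induction₂ (fun x y => g x = g y) ?_ (fun _ _ _ _ _ _ h h' => h.trans h')
    (fun _ _ _ _ h => h.symm) hx hy
  intro x hx
  have hc := hg x hx
  have : ∀ᶠ y in 𝓝[S] x, g y ∈ Metric.ball (g x) 1 := hc (Metric.ball_mem_nhds _ one_pos)
  filter_upwards [this, self_mem_nhdsWithin] with y hy hyS
  have he : Complex.exp (g x) = Complex.exp (g y) := by rw [h x hx, h y hyS]
  obtain ⟨n, hn⟩ := Complex.exp_eq_exp_iff_exists_int.1 he
  have h1 : ‖g y - g x‖ < 1 := by simpa [dist_eq_norm] using hy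
  have h2 : g y - g x = -(n * (2 * Real.pi * Complex.I)) := by rw [hn]; ring
  rw [h2, norm_neg, norm_mul] at h1
  have h3 : ‖(2 * Real.pi * Complex.I : ℂ)‖ = 2 * Real.pi := by
    simp [abs_of_pos Real.pi_pos]
  rw [h3] at h1
  have hn0 : n = 0 := by
    by_contra hne
    have : (1 : ℝ) ≤ ‖(n : ℂ)‖ := by
      rw [Complex.norm_intCast]; exact_mod_cast Int.one_le_abs hne
    nlinarith [Real.pi_gt_three]
  rw [hn, hn0]; simp

/-- The identity has no continuous logarithm on a circle around the origin that extends to a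
nowhere vanishing function on the disc. -/
theorem not_continuous_extension_of_sub {a : ℂ} {R : ℝ} (hR : 0 < R) {h : ℂ → ℂ}
    (hh : Continuous h) (h0 : ∀ z, h z ≠ 0) (hs : ∀ z, ‖z - a‖ = R → h z = z - a) : False := by
  obtain ⟨g, hg, hexp⟩ := exists_log_of_convex (isCompact_closedBall a R) (convex_closedBall a R)
    hh.continuousOn fun z _ => h0 z
  let c : ℝ → ℂ := fun θ => a + R * Complex.exp (θ * Complex.I)
  have hcn : ∀ θ, ‖c θ - a‖ = R := fun θ => by
    simp [c, Complex.norm_exp_ofReal_mul_I, abs_of_pos hR]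
  have hcm : ∀ θ, c θ ∈ Metric.closedBall a R := fun θ => by
    simp [Metric.mem_closedBall, dist_eq_norm, hcn]
  have hcc : Continuous c := by fun_prop
  have hL : Continuous fun θ : ℝ => g (c θ) - θ * Complex.I := by
    refine Continuous.sub ?_ (by fun_prop)
    exact hg.comp_continuous hcc hcm
  have := exp_eq_const_of_preconnected (isPreconnected_univ (α := ℝ)) hL.continuousOn (w := R)
    (fun θ _ => by
      rw [Complex.exp_sub, hexp _ (hcm θ), hs _ (hcn θ)]
      simp [c, Complex.exp_ne_zero]) (mem_univ 0) (mem_univ (2 * Real.pi))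
  have hc0 : c (2 * Real.pi) = c 0 := by simp [c, Complex.exp_two_pi_mul_I]
  rw [hc0] at this
  have h2 : 2 * (Real.pi : ℂ) * Complex.I = 0 := by
    push_cast at this
    linear_combination this
  exact Complex.two_pi_I_ne_zero h2

theorem isPreconnected_compl_closedBall_complex (a : ℂ) {R : ℝ} (hR : 0 ≤ R) :
    IsPreconnected (Metric.closedBall a R)ᶜ := by
  have : (Metric.closedBall a R)ᶜ =
      (fun q : ℝ × ℝ => a + q.1 * Complex.exp (q.2 * Complex.I)) '' (Ioi R ×ˢ univ) := by
    ext z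
    simp only [mem_compl_iff, Metric.mem_closedBall, dist_eq_norm, not_le, mem_image, mem_prod,
      mem_Ioi, mem_univ, and_true, Prod.exists]
    constructor
    · intro hz
      exact ⟨‖z - a‖, Complex.arg (z - a), hz, by rw [Complex.norm_mul_exp_arg_mul_I]; ring⟩
    · rintro ⟨r, θ, hr, rfl⟩
      have : 0 < r := hR.trans_lt hr
      simpa [Complex.norm_exp_ofReal_mul_I, abs_of_pos this] using hr
  rw [this]
  exact (isPreconnected_Ioi.prod isPreconnected_univ).image _ (by fun_prop)

theorem HasQuotientLog.mem_of_isBounded {K : Set ℂ} (hK : IsCompact K) {a b : ℂ} (ha : a ∉ K)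
    (hb : b ∉ K) (h : HasQuotientLog K a b)
    (hbd : Bornology.IsBounded (connectedComponentIn Kᶜ a)) :
    b ∈ connectedComponentIn Kᶜ a := by
  by_contra hbU
  set U := connectedComponentIn Kᶜ a with hU
  have hUo : IsOpen U := hK.isClosed.isOpen_compl.connectedComponentIn
  have haU : a ∈ U := mem_connectedComponentIn ha
  have hfr : frontier U ⊆ K := by
    intro z hz
    by_contra hzK
    rw [frontier, hUo.interior_eq] at hz
    have h1 : IsPreconnected (insert z U) :=
      (isPreconnected_connectedComponentIn (F := Kᶜ) (x := a)).subset_closure (subset_insert _ _)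
        (insert_subset hz.1 subset_closure)
    exact hz.2 (h1.subset_connectedComponentIn (mem_insert_of_mem _ haU)
      (insert_subset hzK (connectedComponentIn_subset _ _)) (mem_insert _ _))
  have hcl : ∀ z ∈ closure U, z ∉ U → z ∈ K := fun z hz hzU =>
    hfr ⟨hz, by rwa [hUo.interior_eq]⟩
  obtain ⟨g, hg, hgK⟩ := h
  obtain ⟨g', hg'⟩ := ContinuousMap.exists_restrict_eq (Y := ℂ) hK.isClosed
    ⟨K.domRestrict g, hg.domRestrict⟩
  have hgg : ∀ z ∈ K, g' z = g z := fun z hz => by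
    have := congrArg (fun F => F ⟨z, hz⟩) hg'
    exact this
  obtain ⟨R, hR⟩ := hbd.subset_ball a
  have hRpos : 0 < R := by
    have := hR haU
    simpa using this
  refine not_continuous_extension_of_sub (a := a) hRpos
    (h := fun z => if z ∈ U then Complex.exp (g' z) * (z - b) else z - a) ?_ ?_ ?_
  · refine Continuous.if ?_ (by fun_prop) (by fun_prop)
    intro z hz
    have hzK := hfr hz
    rw [hgg z hzK, hgK z hzK]
  · intro z
    by_cases hz : z ∈ U
    · simp only [hz, if_true]
      refine mul_ne_zero (Complex.exp_ne_zero _) (sub_ne_zero.2 ?_)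
      rintro rfl; exact hbU hz
    · simp only [hz, if_false]
      refine sub_ne_zero.2 ?_
      rintro rfl; exact hz haU
  · intro z hz
    have : z ∉ U := fun hzU => by
      have := hR hzU
      simp [dist_eq_norm, hz] at this
    simp [this]

theorem HasQuotientLog.unseparated {K : Set ℂ} (hK : IsCompact K) {a b : ℂ} (ha : a ∉ K)
    (hb : b ∉ K) (h : HasQuotientLog K a b) : Unseparated K a b := by
  by_cases hA : Bornology.IsBounded (connectedComponentIn Kᶜ a)
  · exact ⟨_, isPreconnected_connectedComponentIn, connectedComponentIn_subset _ _,
      mem_connectedComponentIn ha, h.mem_of_isBounded hK ha hb hA⟩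
  by_cases hB : Bornology.IsBounded (connectedComponentIn Kᶜ b)
  · exact ⟨_, isPreconnected_connectedComponentIn, connectedComponentIn_subset _ _,
      h.symm.mem_of_isBounded hK hb ha hB, mem_connectedComponentIn hb⟩
  obtain ⟨R, hR0, hR⟩ := hK.isBounded.subset_closedBall_lt 0 0
  have key : ∀ c, ¬ Bornology.IsBounded (connectedComponentIn Kᶜ c) →
      ∃ z ∈ connectedComponentIn Kᶜ c, z ∈ (Metric.closedBall (0 : ℂ) R)ᶜ := by
    intro c hc
    by_contra! hcon
    exact hc (Metric.isBounded_closedBall.subset fun z hz => not_not.1 (hcon z hz))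
  obtain ⟨z, hz, hzR⟩ := key a hA
  obtain ⟨w, hw, hwR⟩ := key b hB
  have hP := isPreconnected_compl_closedBall_complex 0 hR0.le
  refine ⟨connectedComponentIn Kᶜ a ∪ ((Metric.closedBall (0 : ℂ) R)ᶜ ∪
      connectedComponentIn Kᶜ b), ?_, ?_, Or.inl (mem_connectedComponentIn ha),
      Or.inr (Or.inr (mem_connectedComponentIn hb))⟩
  · exact isPreconnected_connectedComponentIn.union z hz (Or.inl hzR)
      (hP.union w hwR hw isPreconnected_connectedComponentIn)
  · exact union_subset (connectedComponentIn_subset _ _) (union_subset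
      (compl_subset_compl.2 hR) (connectedComponentIn_subset _ _))

theorem HasQuotientLog.union {A B : Set ℂ} (hA : IsClosed A) (hB : IsClosed B)
    (hAB : IsPreconnected (A ∩ B)) {a b : ℂ} (hb : b ∉ A ∪ B)
    (h : HasQuotientLog A a b) (h' : HasQuotientLog B a b) :
    HasQuotientLog (A ∪ B) a b := by
  obtain ⟨g, hg, hgA⟩ := h
  obtain ⟨g', hg', hgB⟩ := h'
  have hzb : ∀ z ∈ A ∪ B, z - b ≠ 0 := fun z hz h => hb (by rwa [sub_eq_zero.1 h] at hz)
  obtain ⟨c, hc, hc1⟩ : ∃ c : ℂ, (∀ z ∈ A ∩ B, g z = g' z + c) ∧ Complex.exp c = 1 := by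
    rcases (A ∩ B).eq_empty_or_nonempty with he | ⟨z₀, hz₀⟩
    · exact ⟨0, by simp [he], by simp⟩
    have hone : ∀ z ∈ A ∩ B, Complex.exp (g z - g' z) = 1 := by
      intro z hz
      rw [Complex.exp_sub, div_eq_one_iff_eq (Complex.exp_ne_zero _)]
      exact mul_right_cancel₀ (hzb z (Or.inl hz.1)) ((hgA z hz.1).trans (hgB z hz.2).symm)
    refine ⟨g z₀ - g' z₀, fun z hz => ?_, hone z₀ hz₀⟩
    have := exp_eq_const_of_preconnected hAB (g := fun z => g z - g' z)
      ((hg.mono inter_subset_left).sub (hg'.mono inter_subset_right)) hone hz hz₀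
    rw [← this]; ring
  refine ⟨fun z => if z ∈ A then g z else g' z + c, ?_, fun z hz => ?_⟩
  · have hA' : ContinuousOn (fun z => if z ∈ A then g z else g' z + c) A :=
      hg.congr fun z hz => by simp [hz]
    have hB' : ContinuousOn (fun z => if z ∈ A then g z else g' z + c) B :=
      (hg'.add (continuousOn_const (c := c))).congr fun z hz => by
        by_cases hzA : z ∈ A
        · simp [hzA, hc z ⟨hzA, hz⟩]
        · simp [hzA]
    exact hA'.union_of_isClosed hB' hA hB
  · by_cases hzA : z ∈ A
    · simp [hzA, hgA z hzA]
    · simp [hzA, Complex.exp_add, hc1, hgB z (hz.resolve_left hzA)]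

/-- A homeomorphism onto the complex plane, used to transfer separation results. -/
theorem Unseparated.image_homeomorph {X Y : Type*} [TopologicalSpace X] [TopologicalSpace Y]
    (e : X ≃ₜ Y) {K : Set X} {a b : X} (h : Unseparated K a b) :
    Unseparated (e '' K) (e a) (e b) := by
  obtain ⟨S, hS, hSK, ha, hb⟩ := h
  refine ⟨e '' S, hS.image _ e.continuous.continuousOn, ?_, mem_image_of_mem _ ha,
    mem_image_of_mem _ hb⟩
  rw [← image_compl_eq e.bijective]
  exact image_mono hSK

theorem unseparated_image_iff {X Y : Type*} [TopologicalSpace X] [TopologicalSpace Y]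
    (e : X ≃ₜ Y) {K : Set X} {a b : X} :
    Unseparated (e '' K) (e a) (e b) ↔ Unseparated K a b := by
  refine ⟨fun h => ?_, fun h => h.image_homeomorph e⟩
  simpa [← image_comp] using h.image_homeomorph e.symm

/-- The standard homeomorphism from the real plane to the complex numbers. -/
def planeHomeomorph : ℝ × ℝ ≃ₜ ℂ := Complex.equivRealProdCLM.symm.toHomeomorph

/-- **Janiszewski's theorem**: two compact sets with connected intersection, neither of which
separates two given points, do not jointly separate them. -/
theorem Unseparated.union {A B : Set (ℝ × ℝ)} (hA : IsCompact A) (hB : IsCompact B)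
    (hAB : IsPreconnected (A ∩ B)) {a b : ℝ × ℝ} (h : Unseparated A a b)
    (h' : Unseparated B a b) : Unseparated (A ∪ B) a b := by
  have ha : a ∉ A ∪ B := by
    obtain ⟨S, _, h1, h2, _⟩ := h
    obtain ⟨S', _, h1', h2', _⟩ := h'
    exact fun h => h.elim (h1 h2) (h1' h2')
  have hb : b ∉ A ∪ B := by
    obtain ⟨S, _, h1, _, h2⟩ := h
    obtain ⟨S', _, h1', _, h2'⟩ := h'
    exact fun h => h.elim (h1 h2) (h1' h2')
  rw [← unseparated_image_iff planeHomeomorph] at h h' ⊢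
  have hA' := hA.image planeHomeomorph.continuous
  have hB' := hB.image planeHomeomorph.continuous
  have ha' : planeHomeomorph a ∉ planeHomeomorph '' A ∪ planeHomeomorph '' B := by
    rwa [← image_union, planeHomeomorph.injective.mem_set_image]
  have hb' : planeHomeomorph b ∉ planeHomeomorph '' A ∪ planeHomeomorph '' B := by
    rwa [← image_union, planeHomeomorph.injective.mem_set_image]
  rw [image_union]
  refine HasQuotientLog.unseparated (hA'.union hB') ha' hb' ?_
  refine HasQuotientLog.union hA'.isClosed hB'.isClosed ?_ hb'
    (h.hasQuotientLog hA') (h'.hasQuotientLog hB')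
  rw [← image_inter planeHomeomorph.injective]
  exact hAB.image _ planeHomeomorph.continuous.continuousOn

/-- An arc does not separate the plane. -/
theorem unseparated_arc {γ : ℝ → ℝ × ℝ} {s t : ℝ} (hγ : ContinuousOn γ (Icc s t))
    (hinj : InjOn γ (Icc s t)) {a b : ℝ × ℝ} (ha : a ∉ γ '' Icc s t) (hb : b ∉ γ '' Icc s t) :
    Unseparated (γ '' Icc s t) a b := by
  set e := planeHomeomorph
  have hK : IsCompact (e '' (γ '' Icc s t)) := (isCompact_Icc.image_of_continuousOn hγ).image
    e.continuous
  have ha' : e a ∉ e '' (γ '' Icc s t) := by rwa [e.injective.mem_set_image]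
  have hb' : e b ∉ e '' (γ '' Icc s t) := by rwa [e.injective.mem_set_image]
  rw [← unseparated_image_iff e]
  refine HasQuotientLog.unseparated hK ha' hb' ?_
  set δ : ℝ → ℂ := fun x => e (γ x) with hδ
  have himg : e '' (γ '' Icc s t) = δ '' Icc s t := by rw [← image_comp]; rfl
  rw [himg] at ha' hb' ⊢
  have hδc : ContinuousOn δ (Icc s t) := e.continuous.comp_continuousOn hγ
  have hδi : InjOn δ (Icc s t) := fun x hx y hy h => hinj hx hy (e.injective h)
  have hna : ∀ x ∈ Icc s t, δ x - e a ≠ 0 := fun x hx h =>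
    ha' ⟨x, hx, sub_eq_zero.1 h⟩
  have hnb : ∀ x ∈ Icc s t, δ x - e b ≠ 0 := fun x hx h =>
    hb' ⟨x, hx, sub_eq_zero.1 h⟩
  obtain ⟨G, hG, hGe⟩ := exists_log_of_convex (isCompact_Icc (a := s) (b := t)) (convex_Icc s t)
    (h := fun x => (δ x - e a) / (δ x - e b))
    ((hδc.sub continuousOn_const).div (hδc.sub continuousOn_const) hnb)
    fun x hx => div_ne_zero (hna x hx) (hnb x hx)
  refine ⟨fun z => G (Function.invFunOn δ (Icc s t) z), ?_, ?_⟩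
  · rw [continuousOn_iff_isClosed]
    intro F hF
    obtain ⟨F', hF', hFF⟩ := continuousOn_iff_isClosed.1 hG F hF
    refine ⟨δ '' (F' ∩ Icc s t), ?_, ?_⟩
    · exact ((isCompact_Icc.inter_left hF').image_of_continuousOn
        (hδc.mono inter_subset_right)).isClosed
    · ext z
      constructor
      · rintro ⟨hz, x, hx, rfl⟩
        refine ⟨⟨x, ?_, rfl⟩, x, hx, rfl⟩
        rw [← hFF]
        refine ⟨?_, hx⟩
        simpa [hδi.leftInvOn_invFunOn hx] using hz
      · rintro ⟨⟨x, hx, rfl⟩, -⟩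
        refine ⟨?_, x, hx.2, rfl⟩
        rw [← hFF] at hx
        simpa [hδi.leftInvOn_invFunOn hx.2] using hx.1
  · rintro _ ⟨x, hx, rfl⟩
    simp only [hδi.leftInvOn_invFunOn hx]
    rw [hGe x hx, div_mul_cancel₀ _ (hnb x hx)]

theorem Unseparated.symm {X : Type*} [TopologicalSpace X] {K : Set X} {a b : X}
    (h : Unseparated K a b) : Unseparated K b a := by
  obtain ⟨S, hS, hSK, ha, hb⟩ := h
  exact ⟨S, hS, hSK, hb, ha⟩

theorem Unseparated.trans {X : Type*} [TopologicalSpace X] {K : Set X} {a b c : X}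
    (h : Unseparated K a b) (h' : Unseparated K b c) : Unseparated K a c := by
  obtain ⟨S, hS, hSK, ha, hb⟩ := h
  obtain ⟨S', hS', hSK', hb', hc⟩ := h'
  exact ⟨S ∪ S', hS.union b hb hb' hS', union_subset hSK hSK', Or.inl ha, Or.inr hc⟩

theorem Unseparated.mono {X : Type*} [TopologicalSpace X] {K L : Set X} {a b : X}
    (hLK : L ⊆ K) (h : Unseparated K a b) : Unseparated L a b := by
  obtain ⟨S, hS, hSK, ha, hb⟩ := h
  exact ⟨S, hS, hSK.trans (compl_subset_compl.2 hLK), ha, hb⟩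

theorem Unseparated.left_notMem {X : Type*} [TopologicalSpace X] {K : Set X} {a b : X}
    (h : Unseparated K a b) : a ∉ K := by
  obtain ⟨S, _, hSK, ha, _⟩ := h
  exact hSK ha

theorem Unseparated.right_notMem {X : Type*} [TopologicalSpace X] {K : Set X} {a b : X}
    (h : Unseparated K a b) : b ∉ K := h.symm.left_notMem

theorem mem_connectedComponentIn_compl_iff {X : Type*} [TopologicalSpace X] {K : Set X} {a b : X} :
    b ∈ connectedComponentIn Kᶜ a ↔ Unseparated K a b := by
  constructor
  · intro h
    have ha : a ∈ Kᶜ := connectedComponentIn_nonempty_iff.1 ⟨b, h⟩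
    exact ⟨_, isPreconnected_connectedComponentIn, connectedComponentIn_subset _ _,
      mem_connectedComponentIn ha, h⟩
  · rintro ⟨S, hS, hSK, ha, hb⟩
    exact hS.subset_connectedComponentIn ha hSK hb

theorem frontier_connectedComponentIn_subset {X : Type*} [TopologicalSpace X]
    [LocallyConnectedSpace X] {K : Set X} (hK : IsClosed K) (a : X) :
    frontier (connectedComponentIn Kᶜ a) ⊆ K := by
  intro z hz
  have hUo : IsOpen (connectedComponentIn Kᶜ a) := hK.isOpen_compl.connectedComponentIn
  by_contra hzK
  rw [frontier, hUo.interior_eq] at hz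
  obtain ⟨y, hy⟩ := closure_nonempty_iff.1 ⟨z, hz.1⟩
  have ha : a ∈ Kᶜ := connectedComponentIn_nonempty_iff.1 ⟨y, hy⟩
  have h1 : IsPreconnected (insert z (connectedComponentIn Kᶜ a)) :=
    (isPreconnected_connectedComponentIn (F := Kᶜ) (x := a)).subset_closure (subset_insert _ _)
      (insert_subset hz.1 subset_closure)
  exact hz.2 (h1.subset_connectedComponentIn (mem_insert_of_mem _ (mem_connectedComponentIn ha))
    (insert_subset hzK (connectedComponentIn_subset _ _)) (mem_insert _ _))

theorem IsPreconnected.inter_frontier_nonempty {X : Type*} [TopologicalSpace X] {S f : Set X}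
    (hS : IsPreconnected S) (h1 : (S ∩ f).Nonempty) (h2 : ¬ S ⊆ f) :
    (S ∩ frontier f).Nonempty := by
  by_contra hne
  rw [not_nonempty_iff_eq_empty] at hne
  have hsub : S ⊆ interior f ∪ (closure f)ᶜ := by
    intro z hz
    by_contra hz'
    rw [mem_union, not_or, mem_compl_iff, not_not] at hz'
    exact (hne ▸ (⟨hz, hz'.2, hz'.1⟩ : z ∈ S ∩ frontier f) : z ∈ (∅ : Set X))
  obtain ⟨x, hxS, hxf⟩ := h1
  obtain ⟨y, hyS, hyf⟩ := not_subset.1 h2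
  have hxi : x ∈ interior f := (hsub hxS).resolve_right fun h => h (subset_closure hxf)
  have hyi : y ∈ (closure f)ᶜ := (hsub hyS).resolve_left fun h => hyf (interior_subset h)
  obtain ⟨z, -, hz1, hz2⟩ := hS _ _ isOpen_interior isClosed_closure.isOpen_compl hsub
    ⟨x, hxS, hxi⟩ ⟨y, hyS, hyi⟩
  exact hz2 (subset_closure (interior_subset hz1))

theorem IsPreconnected.insert_of_mem_closure {X : Type*} [TopologicalSpace X] {S : Set X} {y : X}
    (hS : IsPreconnected S) (hy : y ∈ closure S) : IsPreconnected (insert y S) :=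
  hS.subset_closure (subset_insert _ _) (insert_subset hy subset_closure)

/-- Two connected sets with a common closure point off `K` are in one component of the complement
of `K`. -/
theorem Unseparated.of_closure {X : Type*} [TopologicalSpace X] {K S T : Set X} {a b y : X}
    (hS : IsPreconnected S) (hT : IsPreconnected T) (hSK : S ⊆ Kᶜ) (hTK : T ⊆ Kᶜ) (hyK : y ∉ K)
    (ha : a ∈ S) (hb : b ∈ T) (hyS : y ∈ closure S) (hyT : y ∈ closure T) :
    Unseparated K a b :=
  Unseparated.trans (b := y)
    ⟨insert y S, hS.insert_of_mem_closure hyS, insert_subset hyK hSK, mem_insert_of_mem _ ha,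
      mem_insert _ _⟩
    ⟨insert y T, hT.insert_of_mem_closure hyT, insert_subset hyK hTK, mem_insert _ _,
      mem_insert_of_mem _ hb⟩

/-- `K` does not separate any two points. -/
def NonSeparating (K : Set (ℝ × ℝ)) : Prop :=
  ∀ a b, a ∉ K → b ∉ K → Unseparated K a b

theorem NonSeparating.union {A B : Set (ℝ × ℝ)} (hA : IsCompact A) (hB : IsCompact B)
    (hAB : IsPreconnected (A ∩ B)) (h : NonSeparating A) (h' : NonSeparating B) :
    NonSeparating (A ∪ B) := fun a b ha hb =>
  Unseparated.union hA hB hAB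
    (h a b (fun h => ha (Or.inl h)) (fun h => hb (Or.inl h)))
    (h' a b (fun h => ha (Or.inr h)) (fun h => hb (Or.inr h)))

/-- `A` is a simple arc from `p` to `q`. -/
def IsArcFromTo (A : Set (ℝ × ℝ)) (p q : ℝ × ℝ) : Prop :=
  ∃ γ : ℝ → ℝ × ℝ, ContinuousOn γ (Icc 0 1) ∧ InjOn γ (Icc 0 1) ∧ γ 0 = p ∧ γ 1 = q ∧
    γ '' Icc 0 1 = A

namespace IsArcFromTo

variable {A K : Set (ℝ × ℝ)} {p q : ℝ × ℝ}

theorem isCompact (h : IsArcFromTo A p q) : IsCompact A := by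
  obtain ⟨γ, hγ, -, -, -, rfl⟩ := h
  exact isCompact_Icc.image_of_continuousOn hγ

theorem isPreconnected (h : IsArcFromTo A p q) : IsPreconnected A := by
  obtain ⟨γ, hγ, -, -, -, rfl⟩ := h
  exact isPreconnected_Icc.image _ hγ

theorem nonSeparating (h : IsArcFromTo A p q) : NonSeparating A := by
  obtain ⟨γ, hγ, hi, -, -, rfl⟩ := h
  exact fun a b ha hb => unseparated_arc hγ hi ha hb

theorem left_mem (h : IsArcFromTo A p q) : p ∈ A := by
  obtain ⟨γ, hγ, hi, rfl, -, rfl⟩ := h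
  exact ⟨0, by simp, rfl⟩

theorem right_mem (h : IsArcFromTo A p q) : q ∈ A := by
  obtain ⟨γ, hγ, hi, -, rfl, rfl⟩ := h
  exact ⟨1, by simp, rfl⟩

theorem ne (h : IsArcFromTo A p q) : p ≠ q := by
  obtain ⟨γ, hγ, hi, rfl, rfl, -⟩ := h
  intro h
  have := hi (by simp) (by simp) h
  norm_num at this

theorem isPreconnected_diff (h : IsArcFromTo A p q) : IsPreconnected (A \ {p, q}) := by
  obtain ⟨γ, hγ, hi, rfl, rfl, rfl⟩ := h
  have : γ '' Icc 0 1 \ {γ 0, γ 1} = γ '' Ioo 0 1 := by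
    ext z
    constructor
    · rintro ⟨⟨t, ht, rfl⟩, hz⟩
      simp only [mem_insert_iff, mem_singleton_iff, not_or] at hz
      exact ⟨t, ⟨lt_of_le_of_ne ht.1 fun h => hz.1 (by rw [h]),
        lt_of_le_of_ne ht.2 fun h => hz.2 (by rw [h])⟩, rfl⟩
    · rintro ⟨t, ht, rfl⟩
      refine ⟨⟨t, Ioo_subset_Icc_self ht, rfl⟩, ?_⟩
      simp only [mem_insert_iff, mem_singleton_iff, not_or]
      exact ⟨fun h => ht.1.ne' (hi (Ioo_subset_Icc_self ht) (by simp) h),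
        fun h => ht.2.ne (hi (Ioo_subset_Icc_self ht) (by simp) h)⟩
  rw [this]
  exact isPreconnected_Ioo.image _ (hγ.mono Ioo_subset_Icc_self)

theorem subset_closure_diff (h : IsArcFromTo A p q) : A ⊆ closure (A \ {p, q}) := by
  obtain ⟨γ, hγ, hi, rfl, rfl, rfl⟩ := h
  have h1 : γ '' Ioo 0 1 ⊆ γ '' Icc 0 1 \ {γ 0, γ 1} := by
    rintro _ ⟨t, ht, rfl⟩
    refine ⟨⟨t, Ioo_subset_Icc_self ht, rfl⟩, ?_⟩
    simp only [mem_insert_iff, mem_singleton_iff, not_or]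
    exact ⟨fun h => ht.1.ne' (hi (Ioo_subset_Icc_self ht) (by simp) h),
      fun h => ht.2.ne (hi (Ioo_subset_Icc_self ht) (by simp) h)⟩
  refine Subset.trans ?_ (closure_mono h1)
  have h2 := ContinuousOn.image_closure (f := γ) (s := Ioo 0 1)
    (by rwa [closure_Ioo (by norm_num)])
  rwa [closure_Ioo (by norm_num)] at h2

theorem diff_nonempty (h : IsArcFromTo A p q) : (A \ {p, q}).Nonempty := by
  have := h.subset_closure_diff h.left_mem
  exact closure_nonempty_iff.1 ⟨_, this⟩

theorem isPreconnected_diff_right (h : IsArcFromTo A p q) : IsPreconnected (A \ {q}) := by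
  refine h.isPreconnected_diff.subset_closure (fun z hz => ⟨hz.1, fun h => hz.2 (Or.inr h)⟩) ?_
  exact sdiff_subset.trans h.subset_closure_diff

end IsArcFromTo

theorem exists_Icc_subset_of_eventually {γ : ℝ → ℝ × ℝ} (hγ : ContinuousOn γ (Icc 0 1)) {t : ℝ}
    {s : ℝ} (hs : s ≤ 1) (ht : t ∈ Ioo 0 s) {F : Set (ℝ × ℝ)} (hF : IsClosed F) (hz : γ t ∉ F) :
    ∃ t₁ t₂, 0 < t₁ ∧ t₁ < t ∧ t < t₂ ∧ t₂ < s ∧ ∀ r ∈ Ioo t₁ t₂, γ r ∉ F := by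
  have h01 : Icc (0 : ℝ) 1 ∈ 𝓝 t := Icc_mem_nhds ht.1 (ht.2.trans_le hs)
  have h1 : ∀ᶠ r in 𝓝 t, γ r ∉ F := (hγ.continuousAt h01) (hF.isOpen_compl.mem_nhds hz)
  have h2 : ∀ᶠ r in 𝓝 t, r ∈ Ioo 0 s := Ioo_mem_nhds ht.1 ht.2
  obtain ⟨ε, hε, hb⟩ := Metric.eventually_nhds_iff_ball.1 (h1.and h2)
  refine ⟨t - ε / 2, t + ε / 2, ?_, by linarith, by linarith, ?_, fun r hr => ?_⟩
  · refine (hb _ ?_).2.1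
    rw [Metric.mem_ball, Real.dist_eq, abs_lt]; constructor <;> linarith
  · refine (hb _ ?_).2.2
    rw [Metric.mem_ball, Real.dist_eq, abs_lt]; constructor <;> linarith
  · refine (hb _ ?_).1
    rw [Metric.mem_ball, Real.dist_eq, abs_lt]; constructor <;> linarith [hr.1, hr.2]

/-- If the face of `K ∪ A` around `a` touches an interior point of the arc `A`, then its closure
contains the initial point of the arc. -/
theorem IsArcFromTo.left_mem_closure_face {A K : Set (ℝ × ℝ)} {p q a x : ℝ × ℝ}
    (hA : IsArcFromTo A p q) (hK : IsCompact K) (hKA : K ∩ A ⊆ {p, q}) (ha : a ∉ K ∪ A)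
    (hxA : x ∈ A) (hxp : x ≠ p) (hxq : x ≠ q)
    (hx : x ∈ closure (connectedComponentIn (K ∪ A)ᶜ a)) :
    p ∈ closure (connectedComponentIn (K ∪ A)ᶜ a) := by
  set f := connectedComponentIn (K ∪ A)ᶜ a with hf
  have hfc : IsPreconnected f := isPreconnected_connectedComponentIn
  have hfsub : f ⊆ (K ∪ A)ᶜ := connectedComponentIn_subset _ _
  have haf : a ∈ f := mem_connectedComponentIn ha
  have hfr : frontier f ⊆ K ∪ A :=
    frontier_connectedComponentIn_subset (hK.union hA.isCompact).isClosed a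
  have hopen := hA.isPreconnected_diff
  obtain ⟨γ, hγ, hi, rfl, rfl, rfl⟩ := hA
  obtain ⟨s, hs, rfl⟩ := hxA
  have hs0 : 0 < s := lt_of_le_of_ne hs.1 fun h => hxp (by rw [h])
  have hxK : γ s ∉ K := fun h => by
    rcases hKA ⟨h, s, hs, rfl⟩ with h | h
    exacts [hxp h, hxq h]
  have hopenK : γ '' Icc 0 1 \ {γ 0, γ 1} ⊆ Kᶜ := fun z hz hzK => hz.2 (hKA ⟨hzK, hz.1⟩)
  have key : ∀ t ∈ Ioo 0 s, γ t ∈ closure f := by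
    intro t ht
    by_contra hcon
    obtain ⟨t₁, t₂, h0, h1, h2, h3, h4⟩ :=
      exists_Icc_subset_of_eventually hγ hs.2 ht isClosed_closure hcon
    have ht01 : t ∈ Icc (0 : ℝ) 1 := ⟨ht.1.le, (ht.2.le.trans hs.2)⟩
    have hI1 : Icc 0 t₁ ⊆ Icc (0 : ℝ) 1 := Icc_subset_Icc le_rfl (by linarith [hs.2])
    have hI2 : Icc t₂ 1 ⊆ Icc (0 : ℝ) 1 := Icc_subset_Icc (by linarith) le_rfl
    have hγt : γ t ∈ γ '' Icc 0 1 \ {γ 0, γ 1} := by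
      refine ⟨⟨t, ht01, rfl⟩, ?_⟩
      simp only [mem_insert_iff, mem_singleton_iff, not_or]
      exact ⟨fun h => ht.1.ne' (hi ht01 (by simp) h),
        fun h => (ht.2.trans_le hs.2).ne (hi ht01 (by simp) h)⟩
    have hK0 : Unseparated K a (γ t) := by
      refine Unseparated.trans (b := γ s) ⟨insert (γ s) f, hfc.insert_of_mem_closure hx,
        insert_subset hxK fun z hz hzK => hfsub hz (Or.inl hzK), mem_insert_of_mem _ haf,
        mem_insert _ _⟩ ⟨_, hopen, hopenK, ⟨⟨s, hs, rfl⟩, by simp [hxp, hxq]⟩, hγt⟩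
    have ha' : ∀ I ⊆ Icc (0 : ℝ) 1, a ∉ γ '' I := fun I hI h => ha (Or.inr (image_mono hI h))
    have hc1 : IsCompact (γ '' Icc 0 t₁) := isCompact_Icc.image_of_continuousOn (hγ.mono hI1)
    have hc2 : IsCompact (γ '' Icc t₂ 1) := isCompact_Icc.image_of_continuousOn (hγ.mono hI2)
    have hK1 : Unseparated (K ∪ γ '' Icc 0 t₁) a (γ t) := by
      refine hK0.union hK hc1 ?_ (unseparated_arc (hγ.mono hI1) (hi.mono hI1) (ha' _ hI1) ?_)
      · refine (Set.subsingleton_singleton (a := γ 0)).anti ?_ |>.isPreconnected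
        rintro _ ⟨hzK, r, hr, rfl⟩
        rcases hKA ⟨hzK, r, hI1 hr, rfl⟩ with h | h
        · exact h
        · have := hi (hI1 hr) (by simp) h
          linarith [hr.2, hs.2]
      · rintro ⟨r, hr, h⟩
        have := hi (hI1 hr) ht01 h
        linarith [hr.2]
    have hK2 : Unseparated (K ∪ γ '' Icc 0 t₁ ∪ γ '' Icc t₂ 1) a (γ t) := by
      refine hK1.union (hK.union hc1) hc2 ?_
        (unseparated_arc (hγ.mono hI2) (hi.mono hI2) (ha' _ hI2) ?_)
      · refine (Set.subsingleton_singleton (a := γ 1)).anti ?_ |>.isPreconnected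
        rintro _ ⟨hzK | ⟨r', hr', hrr⟩, r, hr, rfl⟩
        · rcases hKA ⟨hzK, r, hI2 hr, rfl⟩ with h | h
          · have := hi (hI2 hr) (by simp) h
            linarith [hr.1]
          · exact h
        · have := hi (hI1 hr') (hI2 hr) hrr
          linarith [hr.1, hr'.2]
      · rintro ⟨r, hr, h⟩
        have := hi (hI2 hr) ht01 h
        linarith [hr.1]
    obtain ⟨S, hS, hSK, haS, htS⟩ := hK2
    obtain ⟨z, hzS, hzf⟩ := hS.inter_frontier_nonempty (f := f) ⟨a, haS, haf⟩
      fun h => hcon (subset_closure (h htS))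
    have hz := hSK hzS
    rcases hfr hzf with hzK | ⟨r, hr, rfl⟩
    · exact hz (Or.inl (Or.inl hzK))
    · refine h4 r ⟨?_, ?_⟩ (frontier_subset_closure hzf)
      · by_contra! h
        exact hz (Or.inl (Or.inr ⟨r, ⟨hr.1, h⟩, rfl⟩))
      · by_contra! h
        exact hz (Or.inr ⟨r, ⟨h, hr.2⟩, rfl⟩)
  have h2 := ContinuousOn.image_closure (f := γ) (s := Ioo 0 s)
    (by rw [closure_Ioo hs0.ne]; exact hγ.mono (Icc_subset_Icc le_rfl hs.2))
  rw [closure_Ioo hs0.ne] at h2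
  have h3 : γ '' Ioo 0 s ⊆ closure f := by
    rintro _ ⟨t, ht, rfl⟩; exact key t ht
  exact closure_minimal h3 isClosed_closure (h2 ⟨0, ⟨le_rfl, hs0.le⟩, rfl⟩)

/-- If `K` does not separate the plane but `K ∪ A` does, then every face of `K ∪ A` has the arc `A`
on its boundary. -/
theorem IsArcFromTo.subset_closure_face {A K : Set (ℝ × ℝ)} {p q a b : ℝ × ℝ}
    (hA : IsArcFromTo A p q) (hK : IsCompact K) (hKA : K ∩ A ⊆ {p, q}) (hns : NonSeparating K)
    (ha : a ∉ K ∪ A) (hb : b ∉ K ∪ A) (hab : ¬ Unseparated (K ∪ A) a b) :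
    A ⊆ closure (connectedComponentIn (K ∪ A)ᶜ a) := by
  set f := connectedComponentIn (K ∪ A)ᶜ a with hf
  have haf : a ∈ f := mem_connectedComponentIn ha
  have hfr : frontier f ⊆ K ∪ A :=
    frontier_connectedComponentIn_subset (hK.union hA.isCompact).isClosed a
  obtain ⟨γ, hγ, hi, rfl, rfl, rfl⟩ := hA
  have key : ∀ t ∈ Ioo (0 : ℝ) 1, γ t ∈ closure f := by
    intro t ht
    by_contra hcon
    obtain ⟨t₁, t₂, h0, h1, h2, h3, h4⟩ :=
      exists_Icc_subset_of_eventually hγ le_rfl ht isClosed_closure hcon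
    have ht01 : t ∈ Icc (0 : ℝ) 1 := ⟨ht.1.le, ht.2.le⟩
    have hI1 : Icc 0 t₁ ⊆ Icc (0 : ℝ) 1 := Icc_subset_Icc le_rfl (by linarith)
    have hI2 : Icc t₂ 1 ⊆ Icc (0 : ℝ) 1 := Icc_subset_Icc (by linarith) le_rfl
    have hc1 : IsCompact (γ '' Icc 0 t₁) := isCompact_Icc.image_of_continuousOn (hγ.mono hI1)
    have hc2 : IsCompact (γ '' Icc t₂ 1) := isCompact_Icc.image_of_continuousOn (hγ.mono hI2)
    have hns2 : NonSeparating (K ∪ γ '' Icc 0 t₁ ∪ γ '' Icc t₂ 1) := by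
      refine NonSeparating.union (hK.union hc1) hc2 ?_ (NonSeparating.union hK hc1 ?_ hns
        fun a b ha hb => unseparated_arc (hγ.mono hI1) (hi.mono hI1) ha hb)
        fun a b ha hb => unseparated_arc (hγ.mono hI2) (hi.mono hI2) ha hb
      · refine (Set.subsingleton_singleton (a := γ 1)).anti ?_ |>.isPreconnected
        rintro _ ⟨hzK | ⟨r', hr', hrr⟩, r, hr, rfl⟩
        · rcases hKA ⟨hzK, r, hI2 hr, rfl⟩ with h | h
          · have := hi (hI2 hr) (by simp) h
            linarith [hr.1]
          · exact h
        · have := hi (hI1 hr') (hI2 hr) hrr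
          linarith [hr.1, hr'.2]
      · refine (Set.subsingleton_singleton (a := γ 0)).anti ?_ |>.isPreconnected
        rintro _ ⟨hzK, r, hr, rfl⟩
        rcases hKA ⟨hzK, r, hI1 hr, rfl⟩ with h | h
        · exact h
        · have := hi (hI1 hr) (by simp) h
          linarith [hr.2]
    have hsub : K ∪ γ '' Icc 0 t₁ ∪ γ '' Icc t₂ 1 ⊆ K ∪ γ '' Icc 0 1 :=
      union_subset (union_subset subset_union_left
        ((image_mono hI1).trans subset_union_right)) ((image_mono hI2).trans subset_union_right)
    obtain ⟨S, hS, hSK, haS, hbS⟩ := hns2 a b (fun h => ha (hsub h)) (fun h => hb (hsub h))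
    obtain ⟨z, hzS, hzf⟩ := hS.inter_frontier_nonempty (f := f) ⟨a, haS, haf⟩
      fun h => hab (mem_connectedComponentIn_compl_iff.1 (h hbS))
    have hz := hSK hzS
    rcases hfr hzf with hzK | ⟨r, hr, rfl⟩
    · exact hz (Or.inl (Or.inl hzK))
    · refine h4 r ⟨?_, ?_⟩ (frontier_subset_closure hzf)
      · by_contra! h
        exact hz (Or.inl (Or.inr ⟨r, ⟨hr.1, h⟩, rfl⟩))
      · by_contra! h
        exact hz (Or.inr ⟨r, ⟨h, hr.2⟩, rfl⟩)
  have h2 := ContinuousOn.image_closure (f := γ) (s := Ioo 0 1)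
    (by rwa [closure_Ioo (by norm_num)])
  rw [closure_Ioo (by norm_num)] at h2
  have h3 : γ '' Ioo 0 1 ⊆ closure f := by
    rintro _ ⟨t, ht, rfl⟩; exact key t ht
  exact h2.trans (closure_minimal h3 isClosed_closure)

/-- Two faces of `A ∪ K` in the same component of the complement of `A` that both touch a connected
set off `K` coincide. -/
theorem Unseparated.of_touch {A K T : Set (ℝ × ℝ)} (hA : IsCompact A) (hK : IsCompact K)
    (hAK : IsPreconnected (A ∩ K)) (hT : IsPreconnected T) (hTK : T ⊆ Kᶜ) {a b y z : ℝ × ℝ}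
    (hab : Unseparated A a b) (ha : a ∉ A ∪ K) (hb : b ∉ A ∪ K) (hy : y ∈ T) (hz : z ∈ T)
    (hya : y ∈ closure (connectedComponentIn (A ∪ K)ᶜ a))
    (hzb : z ∈ closure (connectedComponentIn (A ∪ K)ᶜ b)) : Unseparated (A ∪ K) a b := by
  refine hab.union hA hK hAK ?_
  have hsub : ∀ c, connectedComponentIn (A ∪ K)ᶜ c ⊆ Kᶜ := fun c w hw hwK =>
    connectedComponentIn_subset _ _ hw (Or.inr hwK)
  refine (Unseparated.of_closure isPreconnected_connectedComponentIn hT (hsub a) hTK (hTK hy)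
    (mem_connectedComponentIn ha) hy hya (subset_closure hy)).trans ?_
  exact (Unseparated.of_closure isPreconnected_connectedComponentIn hT (hsub b) hTK (hTK hz)
    (mem_connectedComponentIn hb) hy hzb (subset_closure hz)).symm

/-- A point off `K` on the boundary of a component of the complement of `A` is on the boundary of a
face of `A ∪ K` in that component. -/
theorem exists_face_of_mem_closure {A K : Set (ℝ × ℝ)} (hA : IsCompact A) (hK : IsCompact K)
    (hAK : IsPreconnected (A ∩ K)) {o y : ℝ × ℝ}
    (hy : y ∈ closure (connectedComponentIn Aᶜ o)) (hyK : y ∉ K) :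
    ∃ a, Unseparated A o a ∧ a ∉ A ∪ K ∧ y ∈ closure (connectedComponentIn (A ∪ K)ᶜ a) := by
  obtain ⟨r, hr, hball⟩ := Metric.isOpen_iff.1 hK.isClosed.isOpen_compl y hyK
  obtain ⟨a, ha, hay⟩ := Metric.mem_closure_iff.1 hy r hr
  have hoa := mem_connectedComponentIn_compl_iff.1 ha
  have haB : a ∈ Metric.ball y r := by rwa [Metric.mem_ball, dist_comm]
  refine ⟨a, hoa, ?_, Metric.mem_closure_iff.2 fun ε hε => ?_⟩
  · rintro (h | h)
    exacts [hoa.right_notMem h, hball haB h]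
  · obtain ⟨b, hb, hby⟩ := Metric.mem_closure_iff.1 hy (min ε r) (lt_min hε hr)
    have hbB : b ∈ Metric.ball y r := by
      rw [Metric.mem_ball, dist_comm]; exact hby.trans_le (min_le_right _ _)
    refine ⟨b, mem_connectedComponentIn_compl_iff.2 ?_, hby.trans_le (min_le_left _ _)⟩
    exact (hoa.symm.trans (mem_connectedComponentIn_compl_iff.1 hb)).union hA hK hAK
      ⟨_, (convex_ball y r).isPreconnected, hball, haB, hbB⟩

/-- In a theta configuration `B₁ ∪ B₂ ∪ P`, connected sets that touch common points of both `B₁`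
and `B₂` off the other two arcs are not separated. -/
theorem Unseparated.theta {B₁ B₂ P S T : Set (ℝ × ℝ)} (h₁ : IsCompact B₁) (h₂ : IsCompact B₂)
    (hP : IsCompact P) (hPc : IsPreconnected P) (hB : B₁ ∩ B₂ ⊆ P) (hS : IsPreconnected S)
    (hT : IsPreconnected T) (hSd : S ⊆ (B₁ ∪ B₂ ∪ P)ᶜ) (hTd : T ⊆ (B₁ ∪ B₂ ∪ P)ᶜ)
    {a b y₁ y₂ : ℝ × ℝ} (ha : a ∈ S) (hb : b ∈ T) (hy₁ : y₁ ∉ B₂ ∪ P) (hy₂ : y₂ ∉ B₁ ∪ P)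
    (hS₁ : y₁ ∈ closure S) (hS₂ : y₂ ∈ closure S) (hT₁ : y₁ ∈ closure T)
    (hT₂ : y₂ ∈ closure T) : Unseparated (B₁ ∪ B₂) a b := by
  have e : B₁ ∪ P ∪ (B₂ ∪ P) = B₁ ∪ B₂ ∪ P := by
    ext; simp only [mem_union]; tauto
  have e' : (B₁ ∪ P) ∩ (B₂ ∪ P) = P := by
    rw [← inter_union_distrib_right]; exact union_eq_right.2 hB
  refine Unseparated.mono (K := B₁ ∪ P ∪ (B₂ ∪ P)) (by rw [e]; exact subset_union_left) ?_
  have hs1 : B₁ ∪ P ⊆ B₁ ∪ B₂ ∪ P := by rw [← e]; exact subset_union_left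
  have hs2 : B₂ ∪ P ⊆ B₁ ∪ B₂ ∪ P := by rw [← e]; exact subset_union_right
  refine Unseparated.union (h₁.union hP) (h₂.union hP) (by rwa [e']) ?_ ?_
  · exact Unseparated.of_closure hS hT (hSd.trans (compl_subset_compl.2 hs1))
      (hTd.trans (compl_subset_compl.2 hs1)) hy₂ ha hb hS₂ hT₂
  · exact Unseparated.of_closure hS hT (hSd.trans (compl_subset_compl.2 hs2))
      (hTd.trans (compl_subset_compl.2 hs2)) hy₁ ha hb hS₁ hT₁

section Drawing

variable {V : Type*} [Fintype V] {G : SimpleGraph V} (emb : PlaneEmbedding G)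

/-- The point set of the drawing of a set of edges. -/
def drawE (s : Set (Sym2 V)) : Set (ℝ × ℝ) := ⋃ e ∈ s, arcSet emb e

variable {emb}

theorem mem_drawE {s : Set (Sym2 V)} {z : ℝ × ℝ} :
    z ∈ drawE emb s ↔ ∃ e ∈ s, z ∈ arcSet emb e := by
  simp [drawE]

theorem drawE_mono {s t : Set (Sym2 V)} (h : s ⊆ t) : drawE emb s ⊆ drawE emb t :=
  biUnion_subset_biUnion_left h

theorem drawE_union (s t : Set (Sym2 V)) : drawE emb (s ∪ t) = drawE emb s ∪ drawE emb t :=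
  biUnion_union s t _

theorem drawE_singleton (e : Sym2 V) : drawE emb {e} = arcSet emb e := by
  simp [drawE]

theorem arcSet_subset_drawE {s : Set (Sym2 V)} {e : Sym2 V} (h : e ∈ s) :
    arcSet emb e ⊆ drawE emb s :=
  subset_biUnion_of_mem (u := fun e => arcSet emb e) h

theorem isArcFromTo_arcSet {a b : V} (h : G.Adj a b) :
    IsArcFromTo (arcSet emb s(a, b)) (emb.pos a) (emb.pos b) :=
  emb.arc_curve a b h

theorem pos_mem_arcSet_iff {e : Sym2 V} (he : e ∈ G.edgeSet) {w : V} :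
    emb.pos w ∈ arcSet emb e ↔ w ∈ e := by
  induction e with | _ a b
  rw [SimpleGraph.mem_edgeSet] at he
  rw [Sym2.mem_iff]
  refine ⟨emb.arc_vertex a b he w, ?_⟩
  rintro (rfl | rfl)
  exacts [(isArcFromTo_arcSet he).left_mem, (isArcFromTo_arcSet he).right_mem]

theorem exists_pos_of_mem_arcSet {e e' : Sym2 V} (he : e ∈ G.edgeSet) (he' : e' ∈ G.edgeSet)
    (hne : e ≠ e') {z : ℝ × ℝ} (hz : z ∈ arcSet emb e) (hz' : z ∈ arcSet emb e') :
    ∃ w, w ∈ e ∧ w ∈ e' ∧ emb.pos w = z := by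
  obtain ⟨w, rfl⟩ : z ∈ range emb.pos := by
    induction e with | _ a b
    induction e' with | _ c d
    exact emb.arc_inter a b c d he he' hne ⟨hz, hz'⟩
  exact ⟨w, (pos_mem_arcSet_iff he).1 hz, (pos_mem_arcSet_iff he').1 hz', rfl⟩

theorem isCompact_drawE {s : Set (Sym2 V)} (hs : s ⊆ G.edgeSet) : IsCompact (drawE emb s) := by
  refine (toFinite s).isCompact_biUnion fun e he => ?_
  have := hs he
  induction e with | _ a b
  exact (isArcFromTo_arcSet this).isCompact

theorem pos_mem_drawE_iff {s : Set (Sym2 V)} (hs : s ⊆ G.edgeSet) {w : V} :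
    emb.pos w ∈ drawE emb s ↔ ∃ e ∈ s, w ∈ e := by
  rw [mem_drawE]
  exact exists_congr fun e => and_congr_right fun he => pos_mem_arcSet_iff (hs he)

theorem mem_drawE_inter {s t : Set (Sym2 V)} (hs : s ⊆ G.edgeSet) (ht : t ⊆ G.edgeSet)
    {z : ℝ × ℝ} (hzs : z ∈ drawE emb s) (hzt : z ∈ drawE emb t) :
    z ∈ drawE emb (s ∩ t) ∨ ∃ w, emb.pos w = z ∧ (∃ e ∈ s, w ∈ e) ∧ ∃ e ∈ t, w ∈ e := by
  obtain ⟨e, he, hze⟩ := mem_drawE.1 hzs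
  obtain ⟨e', he', hze'⟩ := mem_drawE.1 hzt
  by_cases h : e = e'
  · subst h
    exact Or.inl (mem_drawE.2 ⟨e, ⟨he, he'⟩, hze⟩)
  · obtain ⟨w, hw, hw', rfl⟩ := exists_pos_of_mem_arcSet (hs he) (ht he') h hze hze'
    exact Or.inr ⟨w, rfl, ⟨e, he, hw⟩, e', he', hw'⟩

theorem notMem_drawE_of_mem_arcSet {s : Set (Sym2 V)} (hs : s ⊆ G.edgeSet) {a b : V}
    (hab : G.Adj a b) (hns : s(a, b) ∉ s) {z : ℝ × ℝ}
    (hz : z ∈ arcSet emb s(a, b) \ {emb.pos a, emb.pos b}) : z ∉ drawE emb s := by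
  intro hzs
  obtain ⟨e, he, hze⟩ := mem_drawE.1 hzs
  obtain ⟨w, hw, -, rfl⟩ := exists_pos_of_mem_arcSet (e := s(a, b)) hab (hs he)
    (fun h => hns (h ▸ he)) hz.1 hze
  rcases Sym2.mem_iff.1 hw with rfl | rfl
  exacts [hz.2 (Or.inl rfl), hz.2 (Or.inr rfl)]

end Drawing

/-- A cyclic parametrisation `u` of a cycle of length `n` in a plane graph, all of whose other
vertices have degree 3 and all their neighbours on the cycle, with other vertices on both sides
of the cycle. -/
structure CycleSetup {V : Type*} {G : SimpleGraph V} (emb : PlaneEmbedding G) where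
  n : ℕ
  u : ℤ → V
  three_le : 3 ≤ n
  eq_iff : ∀ j k, u j = u k ↔ (n : ℤ) ∣ j - k
  adj : ∀ k, G.Adj (u k) (u (k + 1))
  off_nbr : ∀ w, w ∉ range u → ∀ z, G.Adj w z → z ∈ range u
  off_card : ∀ w, w ∉ range u → {z | G.Adj w z}.ncard = 3
  o₁ : V
  o₂ : V
  o₁_off : o₁ ∉ range u
  o₂_off : o₂ ∉ range u
  separated : ¬ Unseparated (drawE emb (range fun k => s(u k, u (k + 1)))) (emb.pos o₁)
    (emb.pos o₂)

namespace CycleSetup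

variable {V : Type*} [Fintype V] {G : SimpleGraph V} {emb : PlaneEmbedding G} (D : CycleSetup emb)

/-- The `k`th edge of the cycle. -/
def E (k : ℤ) : Sym2 V := s(D.u k, D.u (k + 1))

/-- The drawing of the cycle. -/
def cyc : Set (ℝ × ℝ) := drawE emb (range D.E)

/-- The drawing of the path from `u ℓ` to `u r`. -/
def chain (ℓ r : ℤ) : Set (ℝ × ℝ) := drawE emb (D.E '' Ico ℓ r)

/-- The edges of the cycle together with the edges having an end off the cycle. -/
def HE : Set (Sym2 V) := {e | e ∈ G.edgeSet ∧ (e ∈ range D.E ∨ ∃ w ∈ e, w ∉ range D.u)}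

/-- The drawing of the edges of `HE`. -/
def dH : Set (ℝ × ℝ) := drawE emb D.HE

variable {D}

theorem E_mem (k : ℤ) : D.E k ∈ G.edgeSet := D.adj k

theorem range_E_subset : range D.E ⊆ G.edgeSet := by
  rintro _ ⟨k, rfl⟩; exact E_mem k

theorem image_E_subset (s : Set ℤ) : D.E '' s ⊆ G.edgeSet :=
  (image_subset_range _ _).trans range_E_subset

theorem HE_subset : D.HE ⊆ G.edgeSet := fun _ h => h.1

theorem range_E_subset_HE : range D.E ⊆ D.HE := fun _ h => ⟨range_E_subset h, Or.inl h⟩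

theorem mem_E_iff {k : ℤ} {w : V} : w ∈ D.E k ↔ w = D.u k ∨ w = D.u (k + 1) := Sym2.mem_iff

theorem u_injOn {j k : ℤ} (h : D.u j = D.u k) (h1 : j < k + D.n) (h2 : k < j + D.n) : j = k := by
  obtain ⟨c, hc⟩ := (D.eq_iff j k).1 h
  have hn : (0 : ℤ) < D.n := by have := D.three_le; omega
  have : c = 0 := by
    by_contra hc0
    rcases lt_or_gt_of_ne hc0 with h | h <;> nlinarith
  subst this; linarith [hc]

theorem u_add (k : ℤ) : D.u (k + D.n) = D.u k := (D.eq_iff _ _).2 ⟨1, by ring⟩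

theorem u_eq_of_dvd {j k : ℤ} (h : (D.n : ℤ) ∣ j - k) : D.u j = D.u k := (D.eq_iff _ _).2 h

theorem E_eq_iff {j k : ℤ} : D.E j = D.E k ↔ (D.n : ℤ) ∣ j - k := by
  have hn := D.three_le
  constructor
  · intro h
    rcases Sym2.eq_iff.1 h with ⟨h, -⟩ | ⟨h1, h2⟩
    · exact (D.eq_iff _ _).1 h
    · have h3 := (D.eq_iff _ _).1 h1
      have h4 := (D.eq_iff _ _).1 h2
      have h5 : (D.n : ℤ) ∣ 2 := by
        have := dvd_sub h4 h3
        ring_nf at this; exact this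
      have := Int.le_of_dvd (by norm_num) h5
      omega
  · intro h
    rw [E, E, u_eq_of_dvd h, u_eq_of_dvd (j := j + 1) (k := k + 1) (by simpa using h)]

theorem E_add (k : ℤ) : D.E (k + D.n) = D.E k := E_eq_iff.2 ⟨1, by ring⟩

theorem E_injOn {j k : ℤ} (h : D.E j = D.E k) (h1 : j < k + D.n) (h2 : k < j + D.n) : j = k :=
  u_injOn (u_eq_of_dvd (E_eq_iff.1 h)) h1 h2

/-- Every integer has a representative in any window of length `n`. -/
theorem exists_rep (ℓ k : ℤ) : ∃ m, ℓ ≤ m ∧ m < ℓ + D.n ∧ (D.n : ℤ) ∣ k - m := by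
  have hn : (0 : ℤ) < D.n := by have := D.three_le; omega
  refine ⟨ℓ + (k - ℓ) % D.n, ?_, ?_, ?_⟩
  · linarith [Int.emod_nonneg (k - ℓ) hn.ne']
  · linarith [Int.emod_lt_of_pos (k - ℓ) hn]
  · exact ⟨(k - ℓ) / D.n, by linarith [Int.emod_add_mul_ediv (k - ℓ) D.n]⟩

theorem exists_rep_E (ℓ k : ℤ) : ∃ m, ℓ ≤ m ∧ m < ℓ + D.n ∧ D.E k = D.E m := by
  obtain ⟨m, h1, h2, h3⟩ := D.exists_rep ℓ k
  exact ⟨m, h1, h2, E_eq_iff.2 h3⟩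

theorem exists_rep_u (ℓ k : ℤ) : ∃ m, ℓ ≤ m ∧ m < ℓ + D.n ∧ D.u k = D.u m := by
  obtain ⟨m, h1, h2, h3⟩ := D.exists_rep ℓ k
  exact ⟨m, h1, h2, u_eq_of_dvd h3⟩

theorem isArc_E (k : ℤ) : IsArcFromTo (arcSet emb (D.E k)) (emb.pos (D.u k))
    (emb.pos (D.u (k + 1))) := isArcFromTo_arcSet (D.adj k)

theorem isArc_E_rev (k : ℤ) : IsArcFromTo (arcSet emb (D.E k)) (emb.pos (D.u (k + 1)))
    (emb.pos (D.u k)) := by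
  rw [E, Sym2.eq_swap]; exact isArcFromTo_arcSet (D.adj k).symm

theorem isCompact_cyc : IsCompact D.cyc := isCompact_drawE range_E_subset

theorem isCompact_dH : IsCompact D.dH := isCompact_drawE HE_subset

theorem isCompact_chain (ℓ r : ℤ) : IsCompact (D.chain ℓ r) := isCompact_drawE (image_E_subset _)

theorem cyc_subset_dH : D.cyc ⊆ D.dH := drawE_mono range_E_subset_HE

theorem chain_subset_cyc (ℓ r : ℤ) : D.chain ℓ r ⊆ D.cyc := drawE_mono (image_subset_range _ _)

theorem chain_union {ℓ m r : ℤ} (h : ℓ ≤ m) (h' : m ≤ r) :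
    D.chain ℓ m ∪ D.chain m r = D.chain ℓ r := by
  rw [chain, chain, chain, ← drawE_union, ← image_union, Ico_union_Ico_eq_Ico h h']

theorem chain_succ (k : ℤ) : D.chain k (k + 1) = arcSet emb (D.E k) := by
  have : Ico k (k + 1) = {k} := by ext; simp; omega
  rw [chain, this, image_singleton, drawE_singleton]

theorem chain_full (ℓ : ℤ) : D.chain ℓ (ℓ + D.n) = D.cyc := by
  rw [chain, cyc]
  congr 1
  refine (image_subset_range _ _).antisymm ?_
  rintro _ ⟨k, rfl⟩
  obtain ⟨m, h1, h2, h3⟩ := D.exists_rep_E ℓ k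
  exact ⟨m, ⟨h1, h2⟩, h3.symm⟩

theorem pos_mem_chain_iff {ℓ r : ℤ} {w : V} (h : ℓ < r) :
    emb.pos w ∈ D.chain ℓ r ↔ ∃ k, ℓ ≤ k ∧ k ≤ r ∧ w = D.u k := by
  rw [chain, pos_mem_drawE_iff (image_E_subset _)]
  constructor
  · rintro ⟨_, ⟨k, hk, rfl⟩, hw⟩
    rcases mem_E_iff.1 hw with rfl | rfl
    exacts [⟨k, hk.1, hk.2.le, rfl⟩, ⟨k + 1, by linarith [hk.1], by linarith [hk.2], rfl⟩]
  · rintro ⟨k, h1, h2, rfl⟩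
    rcases h2.lt_or_eq with h2 | rfl
    · exact ⟨_, ⟨k, ⟨h1, h2⟩, rfl⟩, mem_E_iff.2 (Or.inl rfl)⟩
    · exact ⟨_, ⟨k - 1, ⟨by linarith, by linarith⟩, rfl⟩, mem_E_iff.2 (Or.inr (by simp))⟩

theorem pos_mem_cyc_iff {w : V} : emb.pos w ∈ D.cyc ↔ w ∈ range D.u := by
  rw [cyc, pos_mem_drawE_iff range_E_subset]
  constructor
  · rintro ⟨_, ⟨k, rfl⟩, hw⟩
    rcases mem_E_iff.1 hw with rfl | rfl <;> exact ⟨_, rfl⟩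
  · rintro ⟨k, rfl⟩
    exact ⟨_, ⟨k, rfl⟩, mem_E_iff.2 (Or.inl rfl)⟩

theorem mem_chain_inter {ℓ m r : ℤ} (h : ℓ < m) (h' : m < r) (hr : r ≤ ℓ + D.n) {z : ℝ × ℝ}
    (hz : z ∈ D.chain ℓ m) (hz' : z ∈ D.chain m r) :
    z = emb.pos (D.u m) ∨ r = ℓ + D.n ∧ z = emb.pos (D.u ℓ) := by
  rcases mem_drawE_inter (image_E_subset _) (image_E_subset _) hz hz' with h1 | ⟨w, rfl, -⟩
  · obtain ⟨e, ⟨⟨j, hj, rfl⟩, k, hk, he⟩, -⟩ := mem_drawE.1 h1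
    have := E_injOn he (by linarith [hk.2, hj.1]) (by linarith [hj.2, hk.1])
    exact absurd hk.1 (by linarith [hj.2])
  · obtain ⟨j, hj, hj', rfl⟩ := (pos_mem_chain_iff h).1 hz
    obtain ⟨k, hk, hk', he⟩ := (pos_mem_chain_iff h').1 hz'
    by_cases hjk : k < j + D.n
    · have := u_injOn he (by linarith) hjk
      obtain rfl : j = m := by omega
      exact Or.inl rfl
    · obtain rfl : j = ℓ := by omega
      exact Or.inr ⟨by omega, rfl⟩

theorem chain_induction {P : ℤ → Prop} {ℓ r : ℤ} (h : ℓ < r) (h0 : P (ℓ + 1))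
    (hs : ∀ m, ℓ < m → m + 1 ≤ r → P m → P (m + 1)) : P r := by
  have : ∀ m, ℓ + 1 ≤ m → m ≤ r → P m := by
    intro m hm
    induction m, hm using Int.leInduction with
    | base => exact fun _ => h0
    | succ m hm ih => exact fun hr => hs m (by linarith) hr (ih (by linarith))
  exact this r h le_rfl

theorem isPreconnected_chain {ℓ r : ℤ} (h : ℓ < r) : IsPreconnected (D.chain ℓ r) := by
  refine chain_induction (P := fun m => IsPreconnected (D.chain ℓ m)) h ?_ fun m hm _ ih => ?_
  · rw [chain_succ]; exact (isArc_E ℓ).isPreconnected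
  · rw [← chain_union hm.le (lt_add_one m).le]
    refine ih.union (emb.pos (D.u m)) ((pos_mem_chain_iff hm).2 ⟨m, hm.le, le_rfl, rfl⟩) ?_ ?_
    · exact (pos_mem_chain_iff (lt_add_one m)).2 ⟨m, le_rfl, by linarith, rfl⟩
    · rw [chain_succ]; exact (isArc_E m).isPreconnected

theorem nonSeparating_chain {ℓ r : ℤ} (h : ℓ < r) (h' : r < ℓ + D.n) :
    NonSeparating (D.chain ℓ r) := by
  refine chain_induction (P := fun m => NonSeparating (D.chain ℓ m)) h ?_ fun m hm hr ih => ?_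
  · rw [chain_succ]; exact (isArc_E ℓ).nonSeparating
  · rw [← chain_union hm.le (lt_add_one m).le]
    refine ih.union (isCompact_chain _ _) (isCompact_chain _ _) ?_ ?_
    · refine (subsingleton_of_subset_singleton (a := emb.pos (D.u m)) ?_).isPreconnected
      rintro z ⟨hz, hz'⟩
      exact (mem_chain_inter hm (lt_add_one m) (by linarith) hz hz').resolve_right
        fun h => by linarith [h.1]
    · rw [chain_succ]; exact (isArc_E m).nonSeparating

theorem chain_diff_eq {ℓ m r : ℤ} (h : ℓ < m) (h' : m < r) (hr : r < ℓ + D.n) :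
    D.chain ℓ r \ {emb.pos (D.u ℓ)} = D.chain ℓ m \ {emb.pos (D.u ℓ)} ∪ D.chain m r := by
  rw [← chain_union h.le h'.le, union_sdiff_distrib]
  congr 1
  refine sdiff_eq_left.2 (disjoint_singleton_right.2 fun hz => ?_)
  obtain ⟨k, hk, hk', he⟩ := (pos_mem_chain_iff h').1 hz
  have := u_injOn he (by linarith) (by linarith)
  linarith

theorem isPreconnected_chain_diff_left {ℓ r : ℤ} (h : ℓ < r) (h' : r < ℓ + D.n) :
    IsPreconnected (D.chain ℓ r \ {emb.pos (D.u ℓ)}) := by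
  refine chain_induction (P := fun m => IsPreconnected (D.chain ℓ m \ {emb.pos (D.u ℓ)})) h ?_
    fun m hm hr ih => ?_
  · rw [chain_succ]; exact (isArc_E_rev ℓ).isPreconnected_diff_right
  · rw [chain_diff_eq hm (lt_add_one m) (by linarith)]
    refine ih.union (emb.pos (D.u m)) ⟨(pos_mem_chain_iff hm).2 ⟨m, hm.le, le_rfl, rfl⟩, ?_⟩
      ((pos_mem_chain_iff (lt_add_one m)).2 ⟨m, le_rfl, by linarith, rfl⟩)
      (isPreconnected_chain (lt_add_one m))
    intro he
    have := u_injOn (emb.pos_injective he) (by linarith) (by linarith)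
    linarith

/-- The path from `u ℓ` to `u r` without its ends is connected. -/
theorem isPreconnected_chain_diff {ℓ r : ℤ} (h : ℓ < r) (h' : r < ℓ + D.n) :
    IsPreconnected (D.chain ℓ r \ {emb.pos (D.u ℓ), emb.pos (D.u r)}) := by
  rcases (Int.add_one_le_iff.2 h).eq_or_lt with rfl | h1
  · rw [chain_succ]; exact (isArc_E ℓ).isPreconnected_diff
  · have e : D.chain ℓ r \ {emb.pos (D.u ℓ), emb.pos (D.u r)} =
        D.chain ℓ (r - 1) \ {emb.pos (D.u ℓ)} ∪ D.chain (r - 1) r \ {emb.pos (D.u r)} := by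
      rw [← singleton_union, ← sdiff_sdiff,
        chain_diff_eq (m := r - 1) (by linarith) (by linarith) h',
        union_sdiff_distrib]
      congr 1
      refine sdiff_eq_left.2 (disjoint_singleton_right.2 fun hz => ?_)
      obtain ⟨k, hk, hk', he⟩ := (pos_mem_chain_iff (by linarith)).1 hz.1
      have := u_injOn he (by linarith) (by linarith)
      linarith
    rw [e]
    have hne : ∀ k, k = ℓ ∨ k = r → emb.pos (D.u (r - 1)) ≠ emb.pos (D.u k) := by
      intro k hk he
      have := u_injOn (emb.pos_injective he) (by omega) (by omega)
      omega
    refine (isPreconnected_chain_diff_left (by linarith) (by linarith)).union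
      (emb.pos (D.u (r - 1)))
      ⟨(pos_mem_chain_iff (by linarith)).2 ⟨r - 1, by linarith, le_rfl, rfl⟩, hne _ (Or.inl rfl)⟩
      ⟨(pos_mem_chain_iff (by linarith)).2 ⟨r - 1, le_rfl, by linarith, rfl⟩, hne _ (Or.inr rfl)⟩ ?_
    have := (isArc_E (D := D) (r - 1)).isPreconnected_diff_right
    rwa [← chain_succ, sub_add_cancel] at this

end CycleSetup

namespace CycleSetup

variable {V : Type*} [Fintype V] {G : SimpleGraph V} {emb : PlaneEmbedding G} {D : CycleSetup emb}

theorem leg_notMem {w : V} (hw : w ∉ range D.u) (z : V) : s(w, z) ∉ range D.E := by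
  rintro ⟨k, hk⟩
  have : w ∈ D.E k := hk ▸ Sym2.mem_mk_left _ _
  rcases mem_E_iff.1 this with rfl | rfl <;> exact hw ⟨_, rfl⟩

theorem eq_of_mem_leg {w : V} (hw : w ∉ range D.u) {k : ℤ} (h : G.Adj w (D.u k)) {z : ℝ × ℝ}
    (hz : z ∈ arcSet emb s(w, D.u k)) (hzc : z ∈ D.cyc) : z = emb.pos (D.u k) := by
  by_contra hne
  refine notMem_drawE_of_mem_arcSet range_E_subset h (leg_notMem hw _) ⟨hz, ?_⟩ hzc
  rintro (rfl | rfl)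
  exacts [hw (pos_mem_cyc_iff.1 hzc), hne rfl]

theorem unseparated_of_mem_leg {w : V} (hw : w ∉ range D.u) {k : ℤ} (h : G.Adj w (D.u k))
    {z : ℝ × ℝ} (hz : z ∈ arcSet emb s(w, D.u k)) (hzc : z ∉ D.cyc) :
    Unseparated D.cyc (emb.pos w) z := by
  have hA := isArcFromTo_arcSet (emb := emb) h
  refine ⟨_, hA.isPreconnected_diff_right, ?_, ⟨hA.left_mem, hA.ne⟩, hz, ?_⟩
  · exact fun y hy hyc => hy.2 (eq_of_mem_leg hw h hy.1 hyc)
  · rintro rfl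
    exact hzc (pos_mem_cyc_iff.2 ⟨k, rfl⟩)

theorem exists_other_side (a : ℝ × ℝ) :
    ∃ o, o ∉ range D.u ∧ ¬ Unseparated D.cyc a (emb.pos o) := by
  by_contra! hcon
  exact D.separated ((hcon _ D.o₁_off).symm.trans (hcon _ D.o₂_off))

theorem pos_notMem_cyc {w : V} (hw : w ∉ range D.u) : emb.pos w ∉ D.cyc :=
  fun h => hw (pos_mem_cyc_iff.1 h)

theorem chain_union_full {ℓ r : ℤ} (h : ℓ ≤ r) (h' : r ≤ ℓ + D.n) :
    D.chain ℓ r ∪ D.chain r (ℓ + D.n) = D.cyc := by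
  rw [chain_union h h', chain_full]

theorem cyc_subset_closure {a : ℝ × ℝ} (ha : a ∉ D.cyc) :
    D.cyc ⊆ closure (connectedComponentIn D.cycᶜ a) := by
  obtain ⟨o, ho, hao⟩ := exists_other_side (D := D) a
  have hn := D.three_le
  refine iUnion₂_subset ?_
  rintro _ ⟨k, rfl⟩
  have hc : D.chain (k + 1) (k + D.n) ∪ arcSet emb (D.E k) = D.cyc := by
    rw [union_comm, ← chain_succ, chain_union_full (by omega) (by omega)]
  rw [← hc] at ha hao ⊢
  refine (isArc_E k).subset_closure_face (isCompact_chain _ _) ?_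
    (nonSeparating_chain (by omega) (by omega)) ha (b := emb.pos o) ?_ hao
  · rintro z ⟨hz, hz'⟩
    rw [← chain_succ] at hz'
    rcases mem_chain_inter (by omega) (by omega) le_rfl hz' hz with h | h
    exacts [Or.inr h, Or.inl h.2]
  · rw [hc]; exact pos_notMem_cyc ho

theorem notMem_chain_of_notMem_ends {ℓ r : ℤ} (h : ℓ < r) (h' : r < ℓ + D.n) {z : ℝ × ℝ}
    (hz : z ∈ D.chain ℓ r \ {emb.pos (D.u ℓ), emb.pos (D.u r)}) : z ∉ D.chain r (ℓ + D.n) := by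
  intro hz'
  rcases mem_chain_inter h h' le_rfl hz.1 hz' with h | h
  exacts [hz.2 (Or.inr h), hz.2 (Or.inl h.2)]

theorem pos_left_mem_chain {ℓ r : ℤ} (h : ℓ < r) : emb.pos (D.u ℓ) ∈ D.chain ℓ r :=
  (pos_mem_chain_iff h).2 ⟨ℓ, le_rfl, h.le, rfl⟩

theorem pos_right_mem_chain {ℓ r : ℤ} (h : ℓ < r) : emb.pos (D.u r) ∈ D.chain ℓ r :=
  (pos_mem_chain_iff h).2 ⟨r, h.le, le_rfl, rfl⟩

/-- Two connected sets that avoid the cycle and a crosscut, and whose closures both meet each of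
the two open arcs of the cycle cut out by the crosscut, are on the same side of the cycle. -/
theorem unseparated_of_crosscut {w : V} (hw : w ∉ range D.u) {ℓ r : ℤ} (h : ℓ < r)
    (h' : r < ℓ + D.n) (hℓ : G.Adj w (D.u ℓ)) (hr : G.Adj w (D.u r)) {S T : Set (ℝ × ℝ)}
    (hS : IsPreconnected S) (hT : IsPreconnected T)
    (hSd : S ⊆ (D.cyc ∪ (arcSet emb s(w, D.u ℓ) ∪ arcSet emb s(w, D.u r)))ᶜ)
    (hTd : T ⊆ (D.cyc ∪ (arcSet emb s(w, D.u ℓ) ∪ arcSet emb s(w, D.u r)))ᶜ)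
    {a b y₁ y₂ : ℝ × ℝ} (ha : a ∈ S) (hb : b ∈ T)
    (hy₁ : y₁ ∈ D.chain ℓ r) (hy₁' : y₁ ∉ D.chain r (ℓ + D.n))
    (hy₂ : y₂ ∈ D.chain r (ℓ + D.n)) (hy₂' : y₂ ∉ D.chain ℓ r)
    (hS₁ : y₁ ∈ closure S) (hS₂ : y₂ ∈ closure S) (hT₁ : y₁ ∈ closure T)
    (hT₂ : y₂ ∈ closure T) : Unseparated D.cyc a b := by
  have hAℓ := isArcFromTo_arcSet (emb := emb) hℓ
  have hAr := isArcFromTo_arcSet (emb := emb) hr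
  have hP : ∀ z ∈ arcSet emb s(w, D.u ℓ) ∪ arcSet emb s(w, D.u r), z ∈ D.cyc →
      z = emb.pos (D.u ℓ) ∨ z = emb.pos (D.u r) := fun z hz hzc =>
    hz.imp (fun hz => eq_of_mem_leg hw hℓ hz hzc) (fun hz => eq_of_mem_leg hw hr hz hzc)
  have hrn : emb.pos (D.u ℓ) ∈ D.chain r (ℓ + D.n) := by
    have := pos_right_mem_chain (D := D) h'
    rwa [u_add] at this
  rw [← chain_union_full h.le h'.le] at hSd hTd ⊢
  refine Unseparated.theta (isCompact_chain _ _) (isCompact_chain _ _)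
    (hAℓ.isCompact.union hAr.isCompact)
    (hAℓ.isPreconnected.union (emb.pos w) hAℓ.left_mem hAr.left_mem hAr.isPreconnected)
    ?_ hS hT hSd hTd ha hb ?_ ?_ hS₁ hS₂ hT₁ hT₂
  · rintro z ⟨hz, hz'⟩
    rcases mem_chain_inter h h' le_rfl hz hz' with rfl | ⟨-, rfl⟩
    exacts [Or.inr hAr.right_mem, Or.inl hAℓ.right_mem]
  · rintro (hz | hz)
    · exact hy₁' hz
    · rcases hP _ hz (chain_subset_cyc _ _ hy₁) with rfl | rfl
      exacts [hy₁' hrn, hy₁' (pos_left_mem_chain h')]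
  · rintro (hz | hz)
    · exact hy₂' hz
    · rcases hP _ hz (chain_subset_cyc _ _ hy₂) with rfl | rfl
      exacts [hy₂' (pos_left_mem_chain h), hy₂' (pos_right_mem_chain h)]

theorem component_subset_of_not_unseparated {w : V} (hw : w ∉ range D.u) {ℓ r : ℤ}
    (hℓ : G.Adj w (D.u ℓ)) (hr : G.Adj w (D.u r)) {o : ℝ × ℝ}
    (ho : ¬ Unseparated D.cyc o (emb.pos w)) :
    connectedComponentIn D.cycᶜ o ⊆
      (D.cyc ∪ (arcSet emb s(w, D.u ℓ) ∪ arcSet emb s(w, D.u r)))ᶜ := by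
  rintro z hz hz'
  have hzc : z ∉ D.cyc := connectedComponentIn_subset _ _ hz
  have hoz := mem_connectedComponentIn_compl_iff.1 hz
  rcases hz' with hz' | hz' | hz'
  · exact hzc hz'
  · exact ho (hoz.trans (unseparated_of_mem_leg hw hℓ hz' hzc).symm)
  · exact ho (hoz.trans (unseparated_of_mem_leg hw hr hz' hzc).symm)

theorem exists_mem_chain_diff {ℓ r : ℤ} (h : ℓ < r) (h' : r < ℓ + D.n) :
    ∃ z ∈ D.chain ℓ r, z ∉ D.chain r (ℓ + D.n) := by
  obtain ⟨z, hz⟩ := (isArc_E (D := D) ℓ).diff_nonempty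
  rw [← chain_succ] at hz
  have h1 := notMem_chain_of_notMem_ends (D := D) (lt_add_one ℓ) (by omega) hz
  refine ⟨z, ?_, fun h2 => h1 ?_⟩
  · rw [← chain_union (lt_add_one ℓ).le (by omega : ℓ + 1 ≤ r)]; exact Or.inl hz.1
  · rw [← chain_union (by omega : ℓ + 1 ≤ r) h'.le]; exact Or.inr h2

theorem exists_foot {w : V} (hw : w ∉ range D.u) : ∃ k, G.Adj w (D.u k) := by
  have h3 := D.off_card w hw
  obtain ⟨z, hz⟩ : {z | G.Adj w z}.Nonempty := by
    rw [nonempty_iff_ne_empty]; intro h; rw [h] at h3; simp at h3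
  obtain ⟨k, rfl⟩ := D.off_nbr w hw z hz
  exact ⟨k, hz⟩

/-- Consecutive neighbours on the cycle of a vertex off the cycle, around a given edge. -/
theorem exists_gap {w : V} (hw : w ∉ range D.u) (i : ℤ) :
    ∃ ℓ r, ℓ ≤ i ∧ i < r ∧ r < ℓ + D.n ∧ G.Adj w (D.u ℓ) ∧ G.Adj w (D.u r) ∧
      ∀ m, ℓ < m → m < r → ¬ G.Adj w (D.u m) := by
  obtain ⟨k, hk⟩ := exists_foot hw
  obtain ⟨k₁, h1, h1', e1⟩ := D.exists_rep_u (i - D.n + 1) k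
  obtain ⟨ℓ, ⟨hℓ, hℓi⟩, hℓm⟩ := Int.exists_greatest_of_bdd
    (P := fun m => G.Adj w (D.u m) ∧ m ≤ i) ⟨i, fun z hz => hz.2⟩
    ⟨k₁, by rw [← e1]; exact hk, by omega⟩
  obtain ⟨r, ⟨hr, hri⟩, hrm⟩ := Int.exists_least_of_bdd
    (P := fun m => G.Adj w (D.u m) ∧ i < m) ⟨i, fun z hz => hz.2.le⟩
    ⟨ℓ + D.n, by rw [u_add]; exact hℓ, by have := hℓm k₁ ⟨by rw [← e1]; exact hk, by omega⟩; omega⟩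
  have hgap : ∀ m, ℓ < m → m < r → ¬ G.Adj w (D.u m) := by
    intro m hm hm' ha
    by_cases h : m ≤ i
    · exact absurd (hℓm m ⟨ha, h⟩) (by omega)
    · exact absurd (hrm m ⟨ha, by omega⟩) (by omega)
  refine ⟨ℓ, r, hℓi, hri, ?_, hℓ, hr, hgap⟩
  by_contra hcon
  have h3 := D.off_card w hw
  have : {z | G.Adj w z} ⊆ {D.u ℓ} := by
    intro z hz
    obtain ⟨j, rfl⟩ := D.off_nbr w hw z hz
    obtain ⟨m, hm, hm', e⟩ := D.exists_rep_u ℓ j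
    rcases hm.eq_or_lt with rfl | hm
    · exact e
    · exact absurd (e ▸ hz) (hgap m hm (by omega))
  have := ncard_le_ncard this
  rw [h3, ncard_singleton] at this
  omega

theorem chain_add (ℓ r : ℤ) : D.chain (ℓ + D.n) (r + D.n) = D.chain ℓ r := by
  rw [chain, chain]
  congr 1
  ext e
  constructor
  · rintro ⟨k, hk, rfl⟩
    refine ⟨k - D.n, ⟨by linarith [hk.1], by linarith [hk.2]⟩, ?_⟩
    rw [← E_add, sub_add_cancel]
  · rintro ⟨k, hk, rfl⟩
    exact ⟨k + D.n, ⟨by linarith [hk.1], by linarith [hk.2]⟩, E_add k⟩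

/-- The cycle has only two sides. -/
theorem unseparated_of_not_unseparated {v : V} (hv : v ∉ range D.u) {a b : ℝ × ℝ}
    (ha : a ∉ D.cyc) (hb : b ∉ D.cyc) (hav : ¬ Unseparated D.cyc a (emb.pos v))
    (hbv : ¬ Unseparated D.cyc b (emb.pos v)) : Unseparated D.cyc a b := by
  obtain ⟨ℓ, r, h1, h2, h3, hℓ, hr, -⟩ := exists_gap hv 0
  obtain ⟨y₁, hy₁, hy₁'⟩ := exists_mem_chain_diff (D := D) (h1.trans_lt h2) h3
  obtain ⟨y₂, hy₂, hy₂'⟩ := exists_mem_chain_diff (D := D) h3 (by omega)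
  rw [chain_add] at hy₂'
  exact unseparated_of_crosscut hv (h1.trans_lt h2) h3 hℓ hr
    isPreconnected_connectedComponentIn isPreconnected_connectedComponentIn
    (component_subset_of_not_unseparated hv hℓ hr hav)
    (component_subset_of_not_unseparated hv hℓ hr hbv)
    (mem_connectedComponentIn ha) (mem_connectedComponentIn hb) hy₁ hy₁' hy₂ hy₂'
    (cyc_subset_closure ha (chain_subset_cyc _ _ hy₁))
    (cyc_subset_closure ha (chain_subset_cyc _ _ hy₂))
    (cyc_subset_closure hb (chain_subset_cyc _ _ hy₁))
    (cyc_subset_closure hb (chain_subset_cyc _ _ hy₂))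

variable (D) in
/-- The face of `dH` containing `a`. -/
def face (a : ℝ × ℝ) : Set (ℝ × ℝ) := connectedComponentIn D.dHᶜ a

theorem leg_mem_HE {w : V} (hw : w ∉ range D.u) {z : V} (h : G.Adj w z) : s(w, z) ∈ D.HE :=
  ⟨h, Or.inr ⟨w, Sym2.mem_mk_left _ _, hw⟩⟩

/-- A face on the side of `w` lies between two consecutive legs of `w`. -/
theorem not_unseparated_of_face {w : V} (hw : w ∉ range D.u) {ℓ r : ℤ} (h : ℓ < r)
    (h' : r < ℓ + D.n) (hℓ : G.Adj w (D.u ℓ)) (hr : G.Adj w (D.u r)) {a y₁ y₂ : ℝ × ℝ}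
    (ha : a ∉ D.dH)
    (hy₁ : y₁ ∈ D.chain ℓ r) (hy₁' : y₁ ∉ D.chain r (ℓ + D.n))
    (hy₂ : y₂ ∈ D.chain r (ℓ + D.n)) (hy₂' : y₂ ∉ D.chain ℓ r)
    (hc₁ : y₁ ∈ closure (D.face a)) (hc₂ : y₂ ∈ closure (D.face a)) :
    ¬ Unseparated D.cyc a (emb.pos w) := by
  intro haw
  obtain ⟨o, ho, how⟩ := exists_other_side (D := D) (emb.pos w)
  refine how (haw.symm.trans ?_)
  refine unseparated_of_crosscut hw h h' hℓ hr (S := D.face a)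
    isPreconnected_connectedComponentIn isPreconnected_connectedComponentIn ?_
    (component_subset_of_not_unseparated hw hℓ hr fun h => how h.symm)
    (mem_connectedComponentIn ha) (mem_connectedComponentIn (pos_notMem_cyc ho)) hy₁ hy₁' hy₂ hy₂'
    hc₁ hc₂ (cyc_subset_closure (pos_notMem_cyc ho) (chain_subset_cyc _ _ hy₁))
    (cyc_subset_closure (pos_notMem_cyc ho) (chain_subset_cyc _ _ hy₂))
  refine (connectedComponentIn_subset _ _).trans (compl_subset_compl.2 ?_)
  exact union_subset cyc_subset_dH (union_subset (arcSet_subset_drawE (leg_mem_HE hw hℓ))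
    (arcSet_subset_drawE (leg_mem_HE hw hr)))

theorem chain_subset_closure_diff (ℓ r : ℤ) :
    D.chain ℓ r ⊆ closure (D.chain ℓ r \ {emb.pos (D.u ℓ), emb.pos (D.u r)}) := by
  refine iUnion₂_subset ?_
  rintro _ ⟨k, hk, rfl⟩
  refine (isArc_E k).subset_closure_diff.trans (closure_mono ?_)
  rintro z ⟨hz, hz'⟩
  refine ⟨arcSet_subset_drawE (mem_image_of_mem D.E hk) hz, fun h => hz' ?_⟩
  have key : ∀ w, emb.pos w = z → z ∈ ({emb.pos (D.u k), emb.pos (D.u (k + 1))} : Set _) := by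
    rintro w rfl
    rcases mem_E_iff.1 ((pos_mem_arcSet_iff (E_mem k)).1 hz) with rfl | rfl
    exacts [Or.inl rfl, Or.inr rfl]
  rcases h with h | h
  exacts [key _ h.symm, key _ h.symm]

section Touch

variable {F : Set (Sym2 V)} {ℓ r : ℤ}

theorem exists_touch_decomposition (hF : F ⊆ D.HE) (hEF : range D.E ⊆ F) (h : ℓ < r)
    (h' : r < ℓ + D.n)
    (hclean : ∀ m, ℓ < m → m < r → ∀ e ∈ F, D.u m ∈ e → e ∈ range D.E) :
    ∃ K, IsCompact K ∧ D.cyc ∩ K = D.chain r (ℓ + D.n) ∧ D.cyc ∪ K = drawE emb F := by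
  have hFG := hF.trans HE_subset
  refine ⟨drawE emb (F \ D.E '' Ico ℓ r), isCompact_drawE (sdiff_subset.trans hFG), ?_, ?_⟩
  · have hE : ∀ k, D.E k ∉ D.E '' Ico ℓ r → D.E k ∈ D.E '' Ico r (ℓ + D.n) := by
      intro k hk
      obtain ⟨m, h1, h2, e⟩ := D.exists_rep_E ℓ k
      by_cases hm : m < r
      · exact absurd (⟨m, ⟨h1, hm⟩, e.symm⟩ : D.E k ∈ D.E '' Ico ℓ r) hk
      · exact ⟨m, ⟨by omega, h2⟩, e.symm⟩
    refine Subset.antisymm ?_ (subset_inter (chain_subset_cyc _ _) (drawE_mono ?_))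
    · rintro z ⟨hz, hz'⟩
      rcases mem_drawE_inter range_E_subset (sdiff_subset.trans hFG) hz hz' with
        h1 | ⟨w, rfl, -, e, ⟨heF, he⟩, hwe⟩
      · refine drawE_mono ?_ h1
        rintro _ ⟨⟨k, rfl⟩, -, hk⟩
        exact hE k hk
      · by_cases hec : e ∈ range D.E
        · obtain ⟨k, rfl⟩ := hec
          exact (pos_mem_drawE_iff (image_E_subset _)).2 ⟨_, hE k he, hwe⟩
        · obtain ⟨k, rfl⟩ := pos_mem_cyc_iff.1 hz
          obtain ⟨m, h1, h2, e'⟩ := D.exists_rep_u ℓ k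
          rw [e'] at hwe ⊢
          rcases h1.eq_or_lt with rfl | h1
          · rw [← u_add]; exact pos_right_mem_chain h'
          · by_cases hm : m < r
            · exact absurd (hclean m h1 hm e heF hwe) hec
            · exact (pos_mem_chain_iff h').2 ⟨m, by omega, h2.le, rfl⟩
    · rintro _ ⟨k, hk, rfl⟩
      refine ⟨hEF ⟨k, rfl⟩, ?_⟩
      rintro ⟨j, hj, e⟩
      have := E_injOn e (by linarith [hj.2, hk.1]) (by linarith [hj.1, hk.2])
      linarith [hj.2, hk.1]
  · rw [cyc, ← drawE_union]
    congr 1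
    refine Subset.antisymm (union_subset hEF sdiff_subset) fun e he => ?_
    by_cases h : e ∈ D.E '' Ico ℓ r
    exacts [Or.inl (image_subset_range _ _ h), Or.inr ⟨he, h⟩]

theorem touch_unseparated (hF : F ⊆ D.HE) (hEF : range D.E ⊆ F) (h : ℓ < r)
    (h' : r < ℓ + D.n)
    (hclean : ∀ m, ℓ < m → m < r → ∀ e ∈ F, D.u m ∈ e → e ∈ range D.E)
    {a b y z : ℝ × ℝ} (hab : Unseparated D.cyc a b) (ha : a ∉ drawE emb F) (hb : b ∉ drawE emb F)
    (hy : y ∈ D.chain ℓ r \ {emb.pos (D.u ℓ), emb.pos (D.u r)})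
    (hz : z ∈ D.chain ℓ r \ {emb.pos (D.u ℓ), emb.pos (D.u r)})
    (hya : y ∈ closure (connectedComponentIn (drawE emb F)ᶜ a))
    (hzb : z ∈ closure (connectedComponentIn (drawE emb F)ᶜ b)) :
    Unseparated (drawE emb F) a b := by
  obtain ⟨K, hK, hcK, e⟩ := exists_touch_decomposition hF hEF h h' hclean
  rw [← e] at ha hb hya hzb ⊢
  refine Unseparated.of_touch isCompact_cyc hK ?_ (isPreconnected_chain_diff h h') ?_ hab ha hb hy
    hz hya hzb
  · rw [hcK]; exact isPreconnected_chain h'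
  · intro t ht htK
    exact notMem_chain_of_notMem_ends h h' ht (hcK.subset ⟨chain_subset_cyc _ _ ht.1, htK⟩)

theorem touch_exists_of_mem (hF : F ⊆ D.HE) (hEF : range D.E ⊆ F) (h : ℓ < r)
    (h' : r < ℓ + D.n)
    (hclean : ∀ m, ℓ < m → m < r → ∀ e ∈ F, D.u m ∈ e → e ∈ range D.E)
    {o y : ℝ × ℝ} (ho : o ∉ D.cyc)
    (hy : y ∈ D.chain ℓ r \ {emb.pos (D.u ℓ), emb.pos (D.u r)}) :
    ∃ a, Unseparated D.cyc o a ∧ a ∉ drawE emb F ∧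
      y ∈ closure (connectedComponentIn (drawE emb F)ᶜ a) := by
  obtain ⟨K, hK, hcK, e⟩ := exists_touch_decomposition hF hEF h h' hclean
  rw [← e]
  refine exists_face_of_mem_closure isCompact_cyc hK ?_
    (cyc_subset_closure ho (chain_subset_cyc _ _ hy.1)) fun hyK => ?_
  · rw [hcK]; exact isPreconnected_chain h'
  · exact notMem_chain_of_notMem_ends h h' hy (hcK.subset ⟨chain_subset_cyc _ _ hy.1, hyK⟩)

theorem touch_subset (hF : F ⊆ D.HE) (hEF : range D.E ⊆ F) (h : ℓ < r)
    (h' : r < ℓ + D.n)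
    (hclean : ∀ m, ℓ < m → m < r → ∀ e ∈ F, D.u m ∈ e → e ∈ range D.E)
    {a y : ℝ × ℝ} (ha : a ∉ drawE emb F)
    (hy : y ∈ D.chain ℓ r \ {emb.pos (D.u ℓ), emb.pos (D.u r)})
    (hya : y ∈ closure (connectedComponentIn (drawE emb F)ᶜ a)) :
    D.chain ℓ r ⊆ closure (connectedComponentIn (drawE emb F)ᶜ a) := by
  refine (chain_subset_closure_diff ℓ r).trans (closure_minimal (fun z hz => ?_) isClosed_closure)
  have hac : a ∉ D.cyc := fun h => ha (drawE_mono hEF h)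
  obtain ⟨b, hab, hb, hzb⟩ := touch_exists_of_mem hF hEF h h' hclean hac hz
  have := touch_unseparated hF hEF h h' hclean hab ha hb hy hz hya hzb
  rwa [connectedComponentIn_eq (mem_connectedComponentIn_compl_iff.2 this)]

theorem touch_exists (hF : F ⊆ D.HE) (hEF : range D.E ⊆ F) (h : ℓ < r)
    (h' : r < ℓ + D.n)
    (hclean : ∀ m, ℓ < m → m < r → ∀ e ∈ F, D.u m ∈ e → e ∈ range D.E)
    {o : ℝ × ℝ} (ho : o ∉ D.cyc) :
    ∃ a, Unseparated D.cyc o a ∧ a ∉ drawE emb F ∧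
      D.chain ℓ r ⊆ closure (connectedComponentIn (drawE emb F)ᶜ a) := by
  obtain ⟨y, hy⟩ : (D.chain ℓ r \ {emb.pos (D.u ℓ), emb.pos (D.u r)}).Nonempty :=
    closure_nonempty_iff.1 ⟨_, chain_subset_closure_diff ℓ r (pos_left_mem_chain h)⟩
  obtain ⟨a, h1, h2, h3⟩ := touch_exists_of_mem hF hEF h h' hclean ho hy
  exact ⟨a, h1, h2, touch_subset hF hEF h h' hclean h2 hy h3⟩

end Touch

end CycleSetup

namespace CycleSetup

variable {V : Type*} [Fintype V] {G : SimpleGraph V} {emb : PlaneEmbedding G} {D : CycleSetup emb}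

theorem exists_mem_E_diff {ℓ k r : ℤ} (h : ℓ ≤ k) (hk : k < r) :
    ∃ y ∈ arcSet emb (D.E k), y ∈ D.chain ℓ r \ {emb.pos (D.u ℓ), emb.pos (D.u r)} := by
  obtain ⟨y, hy, hy'⟩ := (isArc_E (D := D) k).diff_nonempty
  refine ⟨y, hy, arcSet_subset_drawE (mem_image_of_mem D.E (⟨h, hk⟩ : k ∈ Ico ℓ r)) hy,
    fun hc => hy' ?_⟩
  have key : ∀ w, y = emb.pos w → y ∈ ({emb.pos (D.u k), emb.pos (D.u (k + 1))} : Set _) := by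
    rintro w rfl
    rcases mem_E_iff.1 ((pos_mem_arcSet_iff (E_mem k)).1 hy) with rfl | rfl
    exacts [Or.inl rfl, Or.inr rfl]
  rcases hc with hc | hc
  exacts [key _ hc, key _ hc]

theorem notMem_chain_of_notMem_ends' {ℓ r : ℤ} (h : ℓ < r) (h' : r < ℓ + D.n) {z : ℝ × ℝ}
    (hz : z ∈ D.chain r (ℓ + D.n) \ {emb.pos (D.u r), emb.pos (D.u (ℓ + D.n))}) :
    z ∉ D.chain ℓ r := by
  rw [← chain_add]
  exact notMem_chain_of_notMem_ends h' (by linarith) hz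

/-- The face of `a` is on the side of `v`, and the part of the cycle on its boundary is the path
from `u ℓ` to `u r`, whose ends are neighbours of `v`. -/
structure GapFace (D : CycleSetup emb) (a : ℝ × ℝ) (v : V) (ℓ r : ℤ) : Prop where
  notMem : a ∉ D.dH
  off : v ∉ range D.u
  adj_left : G.Adj v (D.u ℓ)
  adj_right : G.Adj v (D.u r)
  lt : ℓ < r
  lt_add : r < ℓ + D.n
  side : Unseparated D.cyc a (emb.pos v)
  subset : D.chain ℓ r ⊆ closure (D.face a)
  edges : ∀ k, arcSet emb (D.E k) ⊆ closure (D.face a) → ∃ m, ℓ ≤ m ∧ m < r ∧ (D.n : ℤ) ∣ k - m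
  verts : ∀ k, emb.pos (D.u k) ∈ closure (D.face a) → ∃ m, ℓ ≤ m ∧ m ≤ r ∧ D.u k = D.u m

theorem dH_eq_union {e : Sym2 V} (he : e ∈ D.HE) :
    drawE emb (D.HE \ {e}) ∪ arcSet emb e = D.dH := by
  rw [← drawE_singleton, ← drawE_union, sdiff_union_of_subset (singleton_subset_iff.2 he), dH]

theorem face_subset_compl_cyc (a : ℝ × ℝ) : D.face a ⊆ D.cycᶜ :=
  (connectedComponentIn_subset _ _).trans (compl_subset_compl.2 cyc_subset_dH)

theorem face_eq_of_unique {a : ℝ × ℝ} (ha : a ∉ D.dH) {v : V} (hv : v ∉ range D.u)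
    (huniq : ∀ w, w ∉ range D.u → emb.pos w ∈ closure (D.face a) → w = v) :
    connectedComponentIn (drawE emb (range D.E ∪ G.incidenceSet v))ᶜ a = D.face a := by
  have hF : range D.E ∪ G.incidenceSet v ⊆ D.HE := by
    rintro e (he | he)
    exacts [range_E_subset_HE he, ⟨he.1, Or.inr ⟨v, he.2, hv⟩⟩]
  refine Subset.antisymm ?_ (connectedComponentIn_mono _ (compl_subset_compl.2 (drawE_mono hF)))
  have hF' : a ∈ (drawE emb (range D.E ∪ G.incidenceSet v))ᶜ := fun h => ha (drawE_mono hF h)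
  by_contra hcon
  obtain ⟨z, hz, hzf⟩ := isPreconnected_connectedComponentIn.inter_frontier_nonempty
    ⟨a, mem_connectedComponentIn hF', mem_connectedComponentIn ha⟩ hcon
  have hzF := connectedComponentIn_subset _ _ hz
  have hzH : z ∈ D.dH := frontier_connectedComponentIn_subset isCompact_dH.isClosed a hzf
  have hzc : z ∈ closure (D.face a) := frontier_subset_closure hzf
  obtain ⟨e, he, hze⟩ := mem_drawE.1 hzH
  have heF : e ∉ range D.E ∪ G.incidenceSet v := fun h => hzF (arcSet_subset_drawE h hze)
  obtain ⟨w, hwe, hw⟩ := he.2.resolve_left fun h => heF (Or.inl h)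
  obtain ⟨x, rfl⟩ := Sym2.mem_iff_exists.1 hwe
  have hadj : G.Adj w x := he.1
  obtain ⟨k, rfl⟩ := D.off_nbr w hw x hadj
  have hwv : w ≠ v := by
    rintro rfl
    exact heF (Or.inr ⟨hadj, hwe⟩)
  by_cases hzw : z = emb.pos w
  · exact hwv (huniq w hw (hzw ▸ hzc))
  · have hzk : z ≠ emb.pos (D.u k) := by
      rintro rfl
      exact hzF (drawE_mono subset_union_left (pos_mem_cyc_iff.2 ⟨k, rfl⟩))
    have hsub : D.HE \ {s(w, D.u k)} ⊆ G.edgeSet := sdiff_subset.trans HE_subset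
    refine hwv (huniq w hw ?_)
    have := (isArcFromTo_arcSet (emb := emb) hadj).left_mem_closure_face
      (K := drawE emb (D.HE \ {s(w, D.u k)})) (a := a) (isCompact_drawE hsub) ?_
      (by rwa [dH_eq_union he]) hze hzw hzk (by rwa [dH_eq_union he])
    · rwa [dH_eq_union he] at this
    · rintro y ⟨hy, hy'⟩
      by_contra hy2
      exact notMem_drawE_of_mem_arcSet hsub hadj (fun h => h.2 rfl) ⟨hy', hy2⟩ hy

theorem side_of_mem_closure {a : ℝ × ℝ} (ha : a ∉ D.dH) {v : V} (hv : v ∉ range D.u)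
    (hva : emb.pos v ∈ closure (D.face a)) : Unseparated D.cyc a (emb.pos v) :=
  Unseparated.of_closure (S := D.face a) (T := {emb.pos v}) (y := emb.pos v)
    isPreconnected_connectedComponentIn isPreconnected_singleton (face_subset_compl_cyc a)
    (by simpa using pos_notMem_cyc hv) (pos_notMem_cyc hv) (mem_connectedComponentIn ha) rfl hva
    (subset_closure rfl)

/-- A face with a unique vertex off the cycle and an edge of the cycle on its boundary. -/
theorem exists_gapFace {a : ℝ × ℝ} (ha : a ∉ D.dH) {v : V} (hv : v ∉ range D.u)
    (hva : emb.pos v ∈ closure (D.face a))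
    (huniq : ∀ w, w ∉ range D.u → emb.pos w ∈ closure (D.face a) → w = v) {i : ℤ}
    (hi : arcSet emb (D.E i) ⊆ closure (D.face a)) :
    ∃ ℓ r, ℓ ≤ i ∧ i < r ∧ D.GapFace a v ℓ r := by
  have hside := side_of_mem_closure ha hv hva
  obtain ⟨ℓ, r, hℓi, hir, hrn, hℓ, hr, hgap⟩ := exists_gap hv i
  have hlt : ℓ < r := hℓi.trans_lt hir
  obtain ⟨y₁, hyE, hy₁⟩ := exists_mem_E_diff (D := D) hℓi hir
  have hy₁' := notMem_chain_of_notMem_ends hlt hrn hy₁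
  have key : ∀ z ∈ closure (D.face a), z ∈ D.chain r (ℓ + D.n) → z ∈ D.chain ℓ r := by
    intro z hz hzr
    by_contra hzl
    exact not_unseparated_of_face hv hlt hrn hℓ hr ha hy₁.1 hy₁' hzr hzl (hi hyE) hz hside
  refine ⟨ℓ, r, hℓi, hir, ha, hv, hℓ, hr, hlt, hrn, hside, ?_, fun k hk => ?_, fun k hk => ?_⟩
  · have hface := face_eq_of_unique ha hv huniq
    rw [← hface]
    have hF : range D.E ∪ G.incidenceSet v ⊆ D.HE := by
      rintro e (he | he)
      exacts [range_E_subset_HE he, ⟨he.1, Or.inr ⟨v, he.2, hv⟩⟩]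
    refine touch_subset hF subset_union_left hlt hrn ?_ (fun h => ha (drawE_mono hF h)) hy₁ ?_
    · rintro m hm hm' e (he | ⟨he, hve⟩) hme
      · exact he
      · have hne : v ≠ D.u m := fun h => hv ⟨m, h.symm⟩
        rw [(Sym2.mem_and_mem_iff hne).1 ⟨hve, hme⟩] at he
        exact absurd he (hgap m hm hm')
    · rw [hface]; exact hi hyE
  · obtain ⟨m, h1, h2, h3⟩ := D.exists_rep ℓ k
    refine ⟨m, h1, ?_, h3⟩
    by_contra hm
    obtain ⟨y₂, hy₂E, hy₂⟩ := exists_mem_E_diff (D := D) (not_lt.1 hm) h2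
    rw [← E_eq_iff.2 h3] at hy₂E
    exact notMem_chain_of_notMem_ends' hlt hrn hy₂ (key y₂ (hk hy₂E) hy₂.1)
  · obtain ⟨m, h1, h2, h3⟩ := D.exists_rep_u ℓ k
    refine ⟨m, h1, ?_, h3⟩
    by_contra hm
    rw [h3] at hk
    obtain ⟨j, hj1, hj2, he⟩ := (pos_mem_chain_iff hlt).1
      (key _ hk ((pos_mem_chain_iff hrn).2 ⟨m, by linarith, by linarith, rfl⟩))
    have := u_injOn he (by linarith) (by linarith)
    linarith

/-- Faces on the same side with a common edge of the cycle are equal. -/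
theorem face_eq_of_side {a b : ℝ × ℝ} (ha : a ∉ D.dH) (hb : b ∉ D.dH)
    (hab : Unseparated D.cyc a b) {k : ℤ} (hka : arcSet emb (D.E k) ⊆ closure (D.face a))
    (hkb : arcSet emb (D.E k) ⊆ closure (D.face b)) : D.face a = D.face b := by
  have hn := D.three_le
  obtain ⟨y, hyE, hy⟩ := exists_mem_E_diff (D := D) (le_refl k) (lt_add_one k)
  refine connectedComponentIn_eq (mem_connectedComponentIn_compl_iff.2 ?_)
  exact touch_unseparated (ℓ := k) (r := k + 1) subset_rfl range_E_subset_HE (by omega) (by omega)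
    (by omega) hab ha hb hy hy (hka hyE) (hkb hyE)

theorem exists_face_of_side {o : ℝ × ℝ} (ho : o ∉ D.cyc) (k : ℤ) :
    ∃ a, Unseparated D.cyc o a ∧ a ∉ D.dH ∧ arcSet emb (D.E k) ⊆ closure (D.face a) := by
  have hn := D.three_le
  have := touch_exists (ℓ := k) (r := k + 1) (F := D.HE) subset_rfl range_E_subset_HE (by omega)
    (by omega) (by omega) ho
  rwa [chain_succ] at this

/-- There is a face on the other side of every edge of the cycle. -/
theorem exists_opposite (a : ℝ × ℝ) (k : ℤ) :
    ∃ b, ¬ Unseparated D.cyc a b ∧ b ∉ D.dH ∧ arcSet emb (D.E k) ⊆ closure (D.face b) := by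
  obtain ⟨o, ho, hao⟩ := exists_other_side (D := D) a
  obtain ⟨b, h1, h2, h3⟩ := exists_face_of_side (pos_notMem_cyc ho) k
  exact ⟨b, fun h => hao (h.trans h1.symm), h2, h3⟩

theorem unseparated_of_not_unseparated' {a b c : ℝ × ℝ} (ha : a ∉ D.cyc) (hb : b ∉ D.cyc)
    (hc : c ∉ D.cyc) (hac : ¬ Unseparated D.cyc a c) (hbc : ¬ Unseparated D.cyc b c) :
    Unseparated D.cyc a b := by
  by_cases h₁ : Unseparated D.cyc c (emb.pos D.o₁)
  · exact unseparated_of_not_unseparated D.o₁_off ha hb (fun h => hac (h.trans h₁.symm))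
      fun h => hbc (h.trans h₁.symm)
  · by_cases h₂ : Unseparated D.cyc c (emb.pos D.o₂)
    · exact unseparated_of_not_unseparated D.o₂_off ha hb (fun h => hac (h.trans h₂.symm))
        fun h => hbc (h.trans h₂.symm)
    · by_cases h₃ : Unseparated D.cyc a (emb.pos D.o₁)
      · have ha2 : ¬ Unseparated D.cyc a (emb.pos D.o₂) := fun h => D.separated (h₃.symm.trans h)
        exact absurd (unseparated_of_not_unseparated D.o₂_off ha hc ha2 h₂) hac
      · exact absurd (unseparated_of_not_unseparated D.o₁_off ha hc h₃ h₁) hac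

theorem not_adj_of_mem_face {a : ℝ × ℝ} (ha : a ∉ D.dH) {k : ℤ}
    (h₁ : arcSet emb (D.E (k - 1)) ⊆ closure (D.face a))
    (h₂ : arcSet emb (D.E k) ⊆ closure (D.face a)) {w : V} (hw : w ∉ range D.u)
    (hside : Unseparated D.cyc a (emb.pos w)) : ¬ G.Adj w (D.u k) := by
  intro hadj
  have hn := D.three_le
  obtain ⟨k', hk'1, hk'2, hk'⟩ : ∃ k', k < k' ∧ k' < k + D.n ∧ G.Adj w (D.u k') := by
    obtain ⟨ℓ, r, h1, h2, h3, -, hr, -⟩ := exists_gap hw k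
    exact ⟨r, h2, by omega, hr⟩
  obtain ⟨y₁, hy₁E, hy₁⟩ := exists_mem_E_diff (D := D) le_rfl hk'1
  obtain ⟨y₂, hy₂E, hy₂⟩ := exists_mem_E_diff (D := D) (ℓ := k') (k := k - 1 + D.n)
    (r := k + D.n) (by omega) (by omega)
  rw [E_add] at hy₂E
  exact not_unseparated_of_face hw hk'1 hk'2 hadj hk' ha hy₁.1
    (notMem_chain_of_notMem_ends hk'1 hk'2 hy₁) hy₂.1
    (notMem_chain_of_notMem_ends' hk'1 hk'2 hy₂) (h₂ hy₁E) (h₁ hy₂E) hside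

/-- A vertex of the cycle that is interior to the boundary paths of two faces on different sides
of the cycle has all its neighbours on these paths. -/
theorem nbr_mem_closure {a b : ℝ × ℝ} (ha : a ∉ D.dH) (hb : b ∉ D.dH)
    (hab : ¬ Unseparated D.cyc a b) {k : ℤ}
    (ha₁ : arcSet emb (D.E (k - 1)) ⊆ closure (D.face a))
    (ha₂ : arcSet emb (D.E k) ⊆ closure (D.face a))
    (hb₁ : arcSet emb (D.E (k - 1)) ⊆ closure (D.face b))
    (hb₂ : arcSet emb (D.E k) ⊆ closure (D.face b)) {x : V} (hx : G.Adj (D.u k) x) :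
    x ∈ range D.u ∧ (emb.pos x ∈ closure (D.face a) ∨ emb.pos x ∈ closure (D.face b)) := by
  have hn := D.three_le
  have hac : a ∉ D.cyc := fun h => ha (cyc_subset_dH h)
  have hbc : b ∉ D.cyc := fun h => hb (cyc_subset_dH h)
  have hsides : ∀ c, c ∉ D.cyc → Unseparated D.cyc a c ∨ Unseparated D.cyc b c := by
    intro c hc
    by_contra! h
    exact hab (unseparated_of_not_unseparated' hac hbc hc h.1 h.2)
  have hoff : ∀ w, w ∉ range D.u → ¬ G.Adj w (D.u k) := fun w hw =>
    (hsides _ (pos_notMem_cyc hw)).elim (not_adj_of_mem_face ha ha₁ ha₂ hw)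
      (not_adj_of_mem_face hb hb₁ hb₂ hw)
  have hxc : x ∈ range D.u := by
    by_contra h
    exact hoff x h hx.symm
  refine ⟨hxc, ?_⟩
  have hA := isArcFromTo_arcSet (emb := emb) hx
  by_cases hE : s(D.u k, x) ∈ range D.E
  · obtain ⟨m, hm⟩ := hE
    have hkm : D.u k ∈ D.E m := hm ▸ Sym2.mem_mk_left _ _
    have hm' : D.E m = D.E (k - 1) ∨ D.E m = D.E k := by
      rcases mem_E_iff.1 hkm with h | h
      · right; exact E_eq_iff.2 ((dvd_sub_comm).1 ((D.eq_iff _ _).1 h))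
      · left; refine E_eq_iff.2 ?_
        have := (dvd_sub_comm).1 ((D.eq_iff _ _).1 h)
        rwa [show m - (k - 1) = m + 1 - k by ring]
    left
    rw [hm] at hm'
    rcases hm' with h | h
    · exact ha₁ (h ▸ hA.right_mem)
    · exact ha₂ (h ▸ hA.right_mem)
  have hns : s(D.u k, x) ∉ D.HE := by
    rintro ⟨-, h | ⟨w, hw, hw'⟩⟩
    · exact hE h
    · rcases Sym2.mem_iff.1 hw with rfl | rfl
      exacts [hw' ⟨_, rfl⟩, hw' hxc]
  have hopen : arcSet emb s(D.u k, x) \ {emb.pos (D.u k), emb.pos x} ⊆ D.dHᶜ := fun z hz =>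
    notMem_drawE_of_mem_arcSet HE_subset hx hns hz
  obtain ⟨c, hc⟩ := hA.diff_nonempty
  have hcH : c ∉ D.dH := hopen hc
  have hcl : arcSet emb s(D.u k, x) ⊆ closure (D.face c) :=
    hA.subset_closure_diff.trans (closure_mono
      (hA.isPreconnected_diff.subset_connectedComponentIn hc hopen))
  have hy : emb.pos (D.u k) ∈
      D.chain (k - 1) (k + 1) \ {emb.pos (D.u (k - 1)), emb.pos (D.u (k + 1))} := by
    refine ⟨(pos_mem_chain_iff (by omega)).2 ⟨k, by omega, by omega, rfl⟩, ?_⟩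
    rintro (h | h)
    · have := u_injOn (emb.pos_injective h) (by omega) (by omega)
      omega
    · have := u_injOn (emb.pos_injective h) (by omega) (by omega)
      omega
  have htouch : ∀ d, d ∉ D.dH → emb.pos (D.u k) ∈ closure (D.face d) → Unseparated D.cyc d c →
      emb.pos x ∈ closure (D.face d) := by
    intro d hd hkd hdc
    have := touch_unseparated (F := D.HE) (ℓ := k - 1) (r := k + 1) subset_rfl range_E_subset_HE
      (by omega) (by omega) ?_ hdc hd hcH hy hy hkd (hcl hA.left_mem)
    · rw [show D.face d = D.face c from
        connectedComponentIn_eq (mem_connectedComponentIn_compl_iff.2 this)]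
      exact hcl hA.right_mem
    · intro m hm hm' e he hme
      obtain rfl : m = k := by omega
      refine he.2.resolve_right ?_
      rintro ⟨w, hwe, hw⟩
      have hne : w ≠ D.u m := fun h => hw ⟨m, h.symm⟩
      have := he.1
      rw [(Sym2.mem_and_mem_iff hne).1 ⟨hwe, hme⟩] at this
      exact hoff w hw this
  rcases hsides c fun h => hcH (cyc_subset_dH h) with h | h
  · exact Or.inl (htouch a ha (ha₂ (isArc_E k).left_mem) h)
  · exact Or.inr (htouch b hb (hb₂ (isArc_E k).left_mem) h)

end CycleSetup

namespace CycleSetup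

variable {V : Type*} [Fintype V] {G : SimpleGraph V} {emb : PlaneEmbedding G} {D : CycleSetup emb}

theorem u_ne {j k : ℤ} (h : j ≠ k) (h1 : j < k + D.n) (h2 : k < j + D.n) : D.u j ≠ D.u k :=
  fun e => h (u_injOn e h1 h2)

variable (D) in
/-- No cycle through all vertices of the given cycle is longer. -/
def Longest : Prop :=
  ∀ l : List V, l.Nodup → l.IsChain G.Adj → (∀ x ∈ l.getLast?, ∀ y ∈ l.head?, G.Adj x y) →
    (∀ k, D.u k ∈ l) → l.length ≤ D.n

/-- Replacing a part of the cycle by a path through the same vertices does not increase the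
length. -/
theorem Longest.reroute (hD : D.Longest) (s : ℤ) (m : ℕ) (hm : 0 < m) (hmn : m ≤ D.n) (X : List V)
    (hX : X.Nodup) (hXc : X.IsChain G.Adj) (hdisj : ∀ x ∈ X, ∀ k, s ≤ k → k < s + m → x ≠ D.u k)
    (hl : ∀ y ∈ X.head?, G.Adj (D.u (s + m - 1)) y) (hr : ∀ x ∈ X.getLast?, G.Adj x (D.u s))
    (hX0 : X ≠ []) (hmem : ∀ k, s + m ≤ k → k < s + D.n → D.u k ∈ X) :
    m + X.length ≤ D.n := by
  obtain ⟨m, rfl⟩ : ∃ m', m = m' + 1 := ⟨m - 1, by omega⟩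
  have hlast : ((List.range (m + 1)).map fun i : ℕ => D.u (s + i)).getLast? =
      some (D.u (s + m)) := by
    rw [List.range_succ]; simp
  have hhead : ((List.range (m + 1)).map fun i : ℕ => D.u (s + i)).head? = some (D.u s) := by
    rw [List.range_succ_eq_map]; simp
  have := hD ((List.range (m + 1)).map (fun i : ℕ => D.u (s + i)) ++ X) ?_ ?_ ?_ ?_
  · simpa using this
  · rw [List.nodup_append]
    refine ⟨?_, hX, ?_⟩
    · refine List.Nodup.map_on ?_ List.nodup_range
      intro i hi j hj h
      have hi' := List.mem_range.1 hi
      have hj' := List.mem_range.1 hj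
      have := u_injOn h (by omega) (by omega)
      omega
    · rintro _ hi y hy rfl
      obtain ⟨i, hi, h⟩ := List.mem_map.1 hi
      have := List.mem_range.1 hi
      exact hdisj _ hy (s + i) (by omega) (by push_cast; omega) h.symm
  · rw [List.isChain_append]
    refine ⟨?_, hXc, ?_⟩
    · rw [List.isChain_map, List.isChain_iff_getElem]
      intro i hi
      simp only [List.getElem_range]
      have := D.adj (s + i)
      rwa [show s + (i : ℤ) + 1 = s + ((i + 1 : ℕ) : ℤ) by push_cast; ring] at this
    · intro x hx y hy
      rw [hlast, Option.mem_some_iff] at hx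
      subst hx
      have := hl y hy
      rwa [show s + ((m + 1 : ℕ) : ℤ) - 1 = s + m by push_cast; ring] at this
  · intro x hx y hy
    rw [List.head?_append, hhead] at hy
    simp only [Option.some_or, Option.mem_some_iff] at hy
    subst hy
    rw [List.getLast?_append_of_ne_nil _ hX0] at hx
    exact hr x hx
  · intro k
    obtain ⟨j, h1, h2, h3⟩ := D.exists_rep_u s k
    rw [h3, List.mem_append]
    by_cases h : j < s + (m + 1 : ℕ)
    · left
      refine List.mem_map.2 ⟨(j - s).toNat, List.mem_range.2 (by omega), ?_⟩
      congr 1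
      omega
    · exact Or.inr (hmem j (by omega) h2)

/-- Replacing the path from `u ℓ` to `u r` by a path through the same vertices does not increase the
length. -/
theorem Longest.reroute_path (hD : D.Longest) {ℓ r : ℤ} (h : ℓ < r) (h' : r < ℓ + D.n) (X : List V)
    (hX0 : X ≠ []) (hX : X.Nodup) (hXc : X.IsChain G.Adj)
    (hdisj : ∀ x ∈ X, x ∉ range D.u ∨ ∃ k, x = D.u k ∧ ℓ < k ∧ k < r)
    (hl : ∀ y ∈ X.head?, G.Adj (D.u ℓ) y) (hr : ∀ x ∈ X.getLast?, G.Adj x (D.u r))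
    (hmem : ∀ k, ℓ < k → k < r → D.u k ∈ X) : (X.length : ℤ) ≤ r - ℓ - 1 := by
  have := hD.reroute r (ℓ + D.n - r + 1).toNat (by omega) (by omega) X hX hXc ?_ ?_ hr hX0 ?_
  · omega
  · rintro x hx k hk hk' rfl
    rcases hdisj _ hx with hx | ⟨j, hj, hj1, hj2⟩
    · exact hx ⟨k, rfl⟩
    · rw [← u_add j] at hj
      have := u_injOn hj (by omega) (by omega)
      omega
  · intro y hy
    rw [show r + ((ℓ + D.n - r + 1).toNat : ℤ) - 1 = ℓ + D.n by omega, u_add]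
    exact hl y hy
  · intro k hk hk'
    rw [← sub_add_cancel k (D.n : ℤ), u_add]
    exact hmem _ (by omega) (by omega)

theorem GapFace.edge_subset {a : ℝ × ℝ} {v : V} {ℓ r : ℤ} (h : D.GapFace a v ℓ r) {k : ℤ}
    (h1 : ℓ ≤ k) (h2 : k < r) : arcSet emb (D.E k) ⊆ closure (D.face a) :=
  (arcSet_subset_drawE (mem_image_of_mem D.E (⟨h1, h2⟩ : k ∈ Ico ℓ r))).trans h.subset

section Opposite

variable {a b c : ℝ × ℝ} {v w w' : V} {ℓ ℓ' r r' : ℤ}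

theorem GapFace.ne (hf : D.GapFace a v ℓ r) (hg : D.GapFace b w ℓ' r')
    (hab : ¬ Unseparated D.cyc a b) : v ≠ w := by
  rintro rfl
  exact hab (hf.side.trans hg.side.symm)

theorem GapFace.nbr (hf : D.GapFace a v ℓ r) (hg : D.GapFace b w ℓ' r')
    (hab : ¬ Unseparated D.cyc a b) {k : ℤ} (h1 : ℓ < k) (h2 : k < r) (h1' : ℓ' < k) (h2' : k < r')
    {x : V} (hx : G.Adj (D.u k) x) : ∃ m, (ℓ ≤ m ∧ m ≤ r ∨ ℓ' ≤ m ∧ m ≤ r') ∧ x = D.u m := by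
  obtain ⟨⟨j, rfl⟩, h⟩ := nbr_mem_closure hf.notMem hg.notMem hab
    (hf.edge_subset (k := k - 1) (by omega) (by omega)) (hf.edge_subset (by omega) (by omega))
    (hg.edge_subset (k := k - 1) (by omega) (by omega)) (hg.edge_subset (by omega) (by omega)) hx
  rcases h with h | h
  · obtain ⟨m, h1, h2, e⟩ := hf.verts _ h
    exact ⟨m, Or.inl ⟨h1, h2⟩, e⟩
  · obtain ⟨m, h1, h2, e⟩ := hg.verts _ h
    exact ⟨m, Or.inr ⟨h1, h2⟩, e⟩

theorem ne_u_of_off (hv : v ∉ range D.u) (k : ℤ) : v ≠ D.u k := fun h => hv ⟨k, h.symm⟩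

theorem ne_left {j k : ℤ} (hn : 8 ≤ D.n) (h : j ≠ k) (h1 : j < k + 8) (h2 : k < j + 8) :
    D.u j ≠ D.u k := u_ne h (by omega) (by omega)

theorem adj_of_eq {j k : ℤ} (h : k = j + 1) : G.Adj (D.u j) (D.u k) := h ▸ D.adj j

theorem GapFace.three_three (hn : 8 ≤ D.n) (hD : D.Longest) (hf : D.GapFace a v (ℓ + 1) (ℓ + 4))
    (hg : D.GapFace b w ℓ (ℓ + 3)) (hab : ¬ Unseparated D.cyc a b) : False := by
  have hvw := hf.ne hg hab
  have hv := ne_u_of_off hf.off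
  have hw := ne_u_of_off hg.off
  have := hD.reroute_path (ℓ := ℓ) (r := ℓ + 4) (by omega) (by omega)
    [w, D.u (ℓ + 3), D.u (ℓ + 2), D.u (ℓ + 1), v] (by simp) ?_ ?_ ?_ ?_ ?_ ?_
  · simp at this
  · simp only [List.nodup_cons, List.mem_cons, List.not_mem_nil, or_false, not_or]
    and_intros <;> first
      | exact hvw | exact hvw.symm | exact hw _ | exact (hv _).symm | simp
      | exact ne_left hn (by omega) (by omega) (by omega)
  · simp only [List.isChain_cons_cons, List.isChain_singleton, and_true]
    exact ⟨hg.adj_right, (adj_of_eq (by ring)).symm, (adj_of_eq (by ring)).symm,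
      hf.adj_left.symm⟩
  · simp only [List.forall_mem_cons, List.not_mem_nil, false_imp_iff, implies_true, and_true]
    and_intros <;> first
      | exact Or.inl hg.off | exact Or.inl hf.off
      | (refine Or.inr ⟨_, rfl, ?_, ?_⟩ <;> omega)
  · simpa using hg.adj_left.symm
  · simpa using hf.adj_right
  · intro k hk hk'
    obtain rfl | rfl | rfl : k = ℓ + 1 ∨ k = ℓ + 2 ∨ k = ℓ + 3 := by omega
    all_goals simp

theorem GapFace.two_three_two (hn : 8 ≤ D.n) (hD : D.Longest)
    (hf : D.GapFace a v (ℓ + 1) (ℓ + 4)) (hg : D.GapFace b w ℓ (ℓ + 2))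
    (hh : D.GapFace c w' (ℓ + 3) (ℓ + 5))
    (hab : ¬ Unseparated D.cyc a b) (hac : ¬ Unseparated D.cyc a c) : False := by
  have hvw := hf.ne hg hab
  have hvw' := hf.ne hh hac
  have hv := ne_u_of_off hf.off
  have hw := ne_u_of_off hg.off
  have hw' := ne_u_of_off hh.off
  by_cases hww : w = w'
  · subst hww
    have h3 := D.off_card w hg.off
    have hsub : (({D.u ℓ, D.u (ℓ + 2), D.u (ℓ + 3), D.u (ℓ + 5)} : Finset V) : Set V) ⊆
        {z | G.Adj w z} := by
      intro z hz
      simp only [Finset.coe_insert, Finset.coe_singleton, mem_insert_iff, mem_singleton_iff] at hz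
      rcases hz with rfl | rfl | rfl | rfl
      exacts [hg.adj_left, hg.adj_right, hh.adj_left, hh.adj_right]
    have := ncard_le_ncard hsub
    rw [ncard_coe_finset, h3, Finset.card_insert_of_notMem, Finset.card_insert_of_notMem,
      Finset.card_insert_of_notMem, Finset.card_singleton] at this
    · omega
    all_goals
      simp only [Finset.mem_insert, Finset.mem_singleton, not_or]
      and_intros <;> exact ne_left hn (by omega) (by omega) (by omega)
  have := hD.reroute_path (ℓ := ℓ) (r := ℓ + 5) (by omega) (by omega)
    [w, D.u (ℓ + 2), D.u (ℓ + 1), v, D.u (ℓ + 4), D.u (ℓ + 3), w'] (by simp) ?_ ?_ ?_ ?_ ?_ ?_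
  · simp at this
  · simp only [List.nodup_cons, List.mem_cons, List.not_mem_nil, or_false, not_or]
    and_intros <;> first
      | exact hvw | exact hvw.symm | exact hvw' | exact hww | exact hw _ | exact hv _
      | exact (hv _).symm | exact (hw' _).symm | simp
      | exact ne_left hn (by omega) (by omega) (by omega)
  · simp only [List.isChain_cons_cons, List.isChain_singleton, and_true]
    exact ⟨hg.adj_right, (adj_of_eq (by ring)).symm, hf.adj_left.symm, hf.adj_right,
      (adj_of_eq (by ring)).symm, hh.adj_left.symm⟩
  · simp only [List.forall_mem_cons, List.not_mem_nil, false_imp_iff, implies_true, and_true]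
    and_intros <;> first
      | exact Or.inl hg.off | exact Or.inl hf.off | exact Or.inl hh.off
      | (refine Or.inr ⟨_, rfl, ?_, ?_⟩ <;> omega)
  · simpa using hg.adj_left.symm
  · simpa using hh.adj_right
  · intro k hk hk'
    obtain rfl | rfl | rfl | rfl : k = ℓ + 1 ∨ k = ℓ + 2 ∨ k = ℓ + 3 ∨ k = ℓ + 4 := by omega
    all_goals simp

variable (G) in
/-- No two vertices separate the graph. -/
def NoTwoSeparator : Prop :=
  ∀ (s t : V) (A : Set V), (∀ x ∈ A, ∀ y, G.Adj x y → y ∈ A ∨ y = s ∨ y = t) → s ∉ A → t ∉ A →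
    ∀ x ∈ A, ∀ y, y ∉ A → y = s ∨ y = t

theorem GapFace.three_three_same (hn : 8 ≤ D.n) (hG : NoTwoSeparator G)
    (hf : D.GapFace a v ℓ (ℓ + 3)) (hg : D.GapFace b w ℓ (ℓ + 3))
    (hab : ¬ Unseparated D.cyc a b) : False := by
  have hv := ne_u_of_off hf.off
  have hmem : ∀ z, z ∈ ({D.u (ℓ + 1), D.u (ℓ + 2)} : Set V) ↔ z = D.u (ℓ + 1) ∨ z = D.u (ℓ + 2) :=
    fun z => Iff.rfl
  have := hG (D.u ℓ) (D.u (ℓ + 3)) {D.u (ℓ + 1), D.u (ℓ + 2)} ?_ ?_ ?_ (D.u (ℓ + 1)) (Or.inl rfl) v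
    ?_
  · exact this.elim (hv _) (hv _)
  · intro x hx y hy
    obtain ⟨k, h1, h2, rfl⟩ : ∃ k, ℓ < k ∧ k < ℓ + 3 ∧ x = D.u k := by
      rcases hx with rfl | rfl
      exacts [⟨ℓ + 1, by omega, by omega, rfl⟩, ⟨ℓ + 2, by omega, by omega, rfl⟩]
    obtain ⟨m, hm, rfl⟩ := hf.nbr hg hab h1 h2 h1 h2 hy
    obtain rfl | rfl | rfl | rfl : m = ℓ ∨ m = ℓ + 1 ∨ m = ℓ + 2 ∨ m = ℓ + 3 := by omega
    all_goals simp
  · rw [hmem, not_or]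
    constructor <;> exact ne_left hn (by omega) (by omega) (by omega)
  · rw [hmem, not_or]
    constructor <;> exact ne_left hn (by omega) (by omega) (by omega)
  · rw [hmem, not_or]
    exact ⟨hv _, hv _⟩

theorem GapFace.adj_of_two (hn : 8 ≤ D.n) (hG : NoTwoSeparator G) {p q s t : ℤ}
    (hf : D.GapFace a v ℓ (ℓ + 3)) (hg : D.GapFace b w ℓ' r')
    (hab : ¬ Unseparated D.cyc a b) (hℓ' : ℓ ≤ ℓ') (hr' : r' ≤ ℓ + 3) (hp : ℓ' < p) (hp' : p < r')
    (hne : p ≠ q ∧ p ≠ s ∧ p ≠ t ∧ q ≠ s ∧ q ≠ t)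
    (hq : ℓ ≤ q ∧ q ≤ ℓ + 3) (hs : ℓ ≤ s ∧ s ≤ ℓ + 3) (ht : ℓ ≤ t ∧ t ≤ ℓ + 3) (hst : s ≠ t) :
    G.Adj (D.u p) (D.u q) := by
  by_contra hcon
  have := hG (D.u s) (D.u t) {D.u p} ?_ ?_ ?_ (D.u p) rfl (D.u q) ?_
  · rcases this with h | h
    · exact ne_left hn (by omega) (by omega) (by omega) h
    · exact ne_left hn (by omega) (by omega) (by omega) h
  · rintro _ rfl y hy
    obtain ⟨m, hm, rfl⟩ := hf.nbr hg hab (by omega) (by omega) hp hp' hy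
    have hmp : m ≠ p := fun h => G.loopless.irrefl _ (h ▸ hy)
    have hmq : m ≠ q := fun h => hcon (h ▸ hy)
    obtain rfl | rfl : m = s ∨ m = t := by omega
    all_goals simp
  all_goals exact ne_left hn (by omega) (by omega) (by omega)

theorem GapFace.three_two_left (hn : 8 ≤ D.n) (hD : D.Longest) (hG : NoTwoSeparator G)
    (hf : D.GapFace a v ℓ (ℓ + 3)) (hg : D.GapFace b w ℓ (ℓ + 2))
    (hab : ¬ Unseparated D.cyc a b) : False := by
  have hw := ne_u_of_off hg.off
  have hadj : G.Adj (D.u (ℓ + 1)) (D.u (ℓ + 3)) :=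
    hf.adj_of_two hn hG (s := ℓ) (t := ℓ + 2) hg hab (by omega) (by omega) (by omega) (by omega)
      (by omega) (by omega) (by omega) (by omega) (by omega)
  have := hD.reroute_path (ℓ := ℓ) (r := ℓ + 3) (by omega) (by omega)
    [w, D.u (ℓ + 2), D.u (ℓ + 1)] (by simp) ?_ ?_ ?_ ?_ ?_ ?_
  · simp at this
  · simp only [List.nodup_cons, List.mem_cons, List.not_mem_nil, or_false, not_or]
    and_intros <;> first
      | exact hw _ | simp
      | exact ne_left hn (by omega) (by omega) (by omega)
  · simp only [List.isChain_cons_cons, List.isChain_singleton, and_true]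
    exact ⟨hg.adj_right, (adj_of_eq (by ring)).symm⟩
  · simp only [List.forall_mem_cons, List.not_mem_nil, false_imp_iff, implies_true, and_true]
    and_intros <;> first
      | exact Or.inl hg.off
      | (refine Or.inr ⟨_, rfl, ?_, ?_⟩ <;> omega)
  · simpa using hg.adj_left.symm
  · simpa using hadj
  · intro k hk hk'
    obtain rfl | rfl : k = ℓ + 1 ∨ k = ℓ + 2 := by omega
    all_goals simp

theorem GapFace.three_two_right (hn : 8 ≤ D.n) (hD : D.Longest) (hG : NoTwoSeparator G)
    (hf : D.GapFace a v ℓ (ℓ + 3)) (hg : D.GapFace b w (ℓ + 1) (ℓ + 3))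
    (hab : ¬ Unseparated D.cyc a b) : False := by
  have hw := ne_u_of_off hg.off
  have hadj : G.Adj (D.u (ℓ + 2)) (D.u ℓ) :=
    hf.adj_of_two hn hG (s := ℓ + 1) (t := ℓ + 3) hg hab (by omega) (by omega) (by omega)
      (by omega) (by omega) (by omega) (by omega) (by omega) (by omega)
  have := hD.reroute_path (ℓ := ℓ) (r := ℓ + 3) (by omega) (by omega)
    [D.u (ℓ + 2), D.u (ℓ + 1), w] (by simp) ?_ ?_ ?_ ?_ ?_ ?_
  · simp at this
  · simp only [List.nodup_cons, List.mem_cons, List.not_mem_nil, or_false, not_or]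
    and_intros <;> first
      | exact (hw _).symm | simp
      | exact ne_left hn (by omega) (by omega) (by omega)
  · simp only [List.isChain_cons_cons, List.isChain_singleton, and_true]
    exact ⟨(adj_of_eq (by ring)).symm, hg.adj_left.symm⟩
  · simp only [List.forall_mem_cons, List.not_mem_nil, false_imp_iff, implies_true, and_true]
    and_intros <;> first
      | exact Or.inl hg.off
      | (refine Or.inr ⟨_, rfl, ?_, ?_⟩ <;> omega)
  · simpa using hadj.symm
  · simpa using hg.adj_right
  · intro k hk hk'
    obtain rfl | rfl : k = ℓ + 1 ∨ k = ℓ + 2 := by omega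
    all_goals simp

end Opposite

end CycleSetup

/-- The cyclic parametrisation `D` describes the closed walk `C`. -/
structure CycleSetup.Describes {V : Type*} {G : SimpleGraph V} {emb : PlaneEmbedding G}
    (D : CycleSetup emb) {x : V} (C : G.Walk x x) : Prop where
  length_eq : C.length = D.n
  mem_support : ∀ w, w ∈ C.support ↔ w ∈ range D.u
  mem_edges : ∀ e, e ∈ C.edges ↔ e ∈ range D.E

section Parametrisation

variable {V : Type*} {G : SimpleGraph V} {x : V} {C : G.Walk x x}

/-- The vertices of a closed walk, numbered cyclically. -/
def cyclicVert (C : G.Walk x x) (k : ℤ) : V := C.getVert (k % C.length).toNat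

theorem cyclicVert_eq_getVert {k : ℤ} {i : ℕ} (hi : i < C.length)
    (hk : (C.length : ℤ) ∣ k - i) : cyclicVert C k = C.getVert i := by
  have : k % C.length = i := by
    rw [((Int.modEq_iff_dvd.2 hk).symm).eq, Int.emod_eq_of_lt (by omega) (by omega)]
  rw [cyclicVert, this, Int.toNat_natCast]

theorem exists_natCast_rep (h : 0 < C.length) (k : ℤ) :
    ∃ i : ℕ, i < C.length ∧ (C.length : ℤ) ∣ k - i := by
  refine ⟨(k % C.length).toNat, ?_, ?_⟩
  · have := Int.emod_lt_of_pos k (b := C.length) (by omega)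
    omega
  · rw [Int.toNat_of_nonneg (Int.emod_nonneg _ (by omega))]
    exact Int.dvd_self_sub_emod

theorem cyclicVert_succ (h : 0 < C.length) {k : ℤ} {i : ℕ} (hi : i < C.length)
    (hk : (C.length : ℤ) ∣ k - i) : cyclicVert C (k + 1) = C.getVert (i + 1) := by
  rcases Nat.lt_or_ge (i + 1) C.length with hi' | hi'
  · exact cyclicVert_eq_getVert hi' (by convert hk using 1; push_cast; ring)
  · obtain hi' : i + 1 = C.length := by omega
    rw [cyclicVert_eq_getVert (i := 0) h, hi', C.getVert_zero, C.getVert_length]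
    obtain ⟨c, hc⟩ := hk
    exact ⟨c + 1, by push_cast; rw [mul_add, ← hc]; omega⟩

theorem cyclicVert_adj (h : 0 < C.length) (k : ℤ) :
    G.Adj (cyclicVert C k) (cyclicVert C (k + 1)) := by
  obtain ⟨i, hi, hk⟩ := exists_natCast_rep h k
  rw [cyclicVert_eq_getVert hi hk, cyclicVert_succ h hi hk]
  exact C.adj_getVert_succ hi

theorem cyclicVert_eq_iff (hC : C.IsCycle) (j k : ℤ) :
    cyclicVert C j = cyclicVert C k ↔ (C.length : ℤ) ∣ j - k := by
  have h : 0 < C.length := by have := hC.three_le_length; omega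
  obtain ⟨i, hi, hj⟩ := exists_natCast_rep h j
  obtain ⟨i', hi', hk⟩ := exists_natCast_rep h k
  rw [cyclicVert_eq_getVert hi hj, cyclicVert_eq_getVert hi' hk]
  constructor
  · intro he
    obtain rfl := hC.getVert_injOn' (by simp only [mem_ofPred_eq]; omega)
      (by simp only [mem_ofPred_eq]; omega) he
    simpa using dvd_sub hj hk
  · intro hd
    have : (C.length : ℤ) ∣ i - i' := by
      rw [show (i : ℤ) - i' = j - k - (j - i) + (k - i') by ring]
      exact dvd_add (dvd_sub hd hj) hk
    have := Int.eq_zero_of_abs_lt_dvd this (by rw [abs_lt]; omega)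
    rw [show i = i' by omega]

theorem mem_support_iff_cyclicVert (h : 0 < C.length) (w : V) :
    w ∈ C.support ↔ w ∈ range (cyclicVert C) := by
  rw [SimpleGraph.Walk.mem_support_iff_exists_getVert]
  constructor
  · rintro ⟨i, rfl, hi⟩
    rcases hi.lt_or_eq with hi | rfl
    · exact ⟨i, cyclicVert_eq_getVert hi (by simp)⟩
    · exact ⟨0, by rw [cyclicVert_eq_getVert (i := 0) h (by simp), C.getVert_zero,
        C.getVert_length]⟩
  · rintro ⟨k, rfl⟩
    obtain ⟨i, hi, hk⟩ := exists_natCast_rep h k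
    exact ⟨i, (cyclicVert_eq_getVert hi hk).symm, hi.le⟩

theorem mem_edges_iff_cyclicVert (h : 0 < C.length) (e : Sym2 V) :
    e ∈ C.edges ↔ e ∈ range fun k => s(cyclicVert C k, cyclicVert C (k + 1)) := by
  constructor
  · induction e with | _ a b
    rw [SimpleGraph.Walk.mk_mem_edges_iff_exists]
    rintro ⟨i, hi, he⟩
    exact ⟨i, by simp only [cyclicVert_eq_getVert hi (k := i) (by simp),
      cyclicVert_succ h hi (k := i) (by simp), he]⟩
  · rintro ⟨k, rfl⟩
    obtain ⟨i, hi, hk⟩ := exists_natCast_rep h k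
    simp only [cyclicVert_eq_getVert hi hk, cyclicVert_succ h hi hk]
    exact (SimpleGraph.Walk.mk_mem_edges_iff_exists C).2 ⟨i, hi, rfl⟩

end Parametrisation

section Bridge

variable {V : Type*} [Fintype V] {G : SimpleGraph V} {emb : PlaneEmbedding G} {x : V}
  {C : G.Walk x x}

theorem exists_describes (hC : C.IsCycle) (hI : IsIsolating G C) (hVm : (Vminus emb C).Nonempty)
    (hVp : (Vplus emb C).Nonempty) : ∃ D : CycleSetup emb, D.Describes C := by
  have h : 0 < C.length := by have := hC.three_le_length; omega
  have hsupp := mem_support_iff_cyclicVert (C := C) h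
  obtain ⟨o₁, ho₁⟩ := hVm
  obtain ⟨o₂, ho₂⟩ := hVp
  simp only [Vplus, Finset.mem_filter, Finset.mem_univ, true_and] at ho₂
  obtain ⟨ho₂, ho₂'⟩ := ho₂
  have ho₁' := ho₁
  simp only [Vminus, Finset.mem_filter, Finset.mem_univ, true_and] at ho₁ ho₂'
  have hdraw : drawC emb C =
      drawE emb (range fun k => s(cyclicVert C k, cyclicVert C (k + 1))) := by
    ext z
    simp only [drawC, drawE, mem_iUnion, mem_edges_iff_cyclicVert h]
  refine ⟨{
    n := C.length
    u := cyclicVert C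
    three_le := hC.three_le_length
    eq_iff := cyclicVert_eq_iff hC
    adj := cyclicVert_adj h
    off_nbr := fun w hw z hz => (hsupp z).1 ((hI w (mt (hsupp w).1 hw)).2 z hz)
    off_card := fun w hw => ?_
    o₁ := o₁
    o₂ := o₂
    o₁_off := mt (hsupp _).2 ho₁.1
    o₂_off := mt (hsupp _).2 ho₂
    separated := fun hU => ho₂' ⟨ho₂, ?_⟩ }, rfl, hsupp, mem_edges_iff_cyclicVert h⟩
  · rw [← (hI w (mt (hsupp w).1 hw)).1, ← ncard_coe_finset]
    simp
  · rw [← hdraw] at hU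
    refine ⟨hU.right_notMem, ?_⟩
    rw [← connectedComponentIn_eq (mem_connectedComponentIn_compl_iff.2 hU)]
    exact ho₁.2.2

end Bridge

section Bridge

variable {V : Type*} [Fintype V] {G : SimpleGraph V} {emb : PlaneEmbedding G} {x : V}
  {C : G.Walk x x} {D : CycleSetup emb}

theorem noTwoSeparator_of_threeConnected (h : ThreeConnected G) :
    CycleSetup.NoTwoSeparator G := by
  intro s t A hA hs ht p hp q hq
  by_contra! hne
  have hp' : p ∈ ((({s, t} : Finset V) : Set V)ᶜ) := by
    simp only [Finset.coe_insert, Finset.coe_singleton, mem_compl_iff, mem_insert_iff,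
      mem_singleton_iff, not_or]
    exact ⟨fun h => hs (h ▸ hp), fun h => ht (h ▸ hp)⟩
  have hq' : q ∈ ((({s, t} : Finset V) : Set V)ᶜ) := by simpa using hne
  obtain ⟨W⟩ := (h.2 {s, t} Finset.card_le_two).preconnected ⟨p, hp'⟩ ⟨q, hq'⟩
  have : ∀ (a b : ↥((({s, t} : Finset V) : Set V)ᶜ)) (_ : (G.induce _).Walk a b),
      a.1 ∈ A → b.1 ∈ A := by
    intro a b W
    induction W with
    | nil => exact id
    | cons hadj _ ih =>
      rename_i a b c _
      intro ha
      refine ih ((hA _ ha _ hadj).resolve_right ?_)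
      simpa using b.2
  exact hq (this _ _ W hp)

theorem CycleSetup.Describes.longest (hD : D.Describes C) (hC : IsLongestIsolatingCycle G C) :
    D.Longest := by
  intro l hl hchain hclose hmem
  by_contra! hlt
  have h3 := D.three_le
  have hne : l ≠ [] := by rintro rfl; simp at hlt
  have hadj : G.Adj (l.getLast hne) (l.head hne) :=
    hclose _ (List.getLast?_eq_some_getLast hne) _ (List.head?_eq_some_head hne)
  set W := SimpleGraph.Walk.ofSupport l hne hchain with hW
  have hsupp : W.support = l := SimpleGraph.Walk.support_ofSupport hne hchain
  have hlen : W.length = l.length - 1 := SimpleGraph.Walk.length_ofSupport hne hchain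
  have hpath : W.IsPath := SimpleGraph.Walk.IsPath.mk' (by rwa [hsupp])
  have hcyc : (SimpleGraph.Walk.cons hadj W).IsCycle := by
    rw [SimpleGraph.Walk.cons_isCycle_iff]
    refine ⟨hpath, fun h => ?_⟩
    rw [Sym2.eq_swap] at h
    have := hpath.length_eq_one_of_mem_edges h
    omega
  have hsub : ∀ w, w ∈ C.support → w ∈ (SimpleGraph.Walk.cons hadj W).support := by
    intro w hw
    obtain ⟨k, rfl⟩ := (hD.mem_support w).1 hw
    rw [SimpleGraph.Walk.support_cons, hsupp]
    exact List.mem_cons_of_mem _ (hmem k)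
  have := hC.2.2 _ _ hcyc fun v hv => ⟨(hC.2.1 v (mt (hsub v) hv)).1,
    fun w hw => hsub w ((hC.2.1 v (mt (hsub v) hv)).2 w hw)⟩
  rw [SimpleGraph.Walk.length_cons, hD.length_eq] at this
  omega

namespace CycleSetup.Describes

variable (hD : D.Describes C)
include hD

theorem drawingH_eq : drawingH emb C = D.dH := by
  have hH : ∀ a b, (Hgraph C).Adj a b ↔ s(a, b) ∈ D.HE := by
    intro a b
    simp only [Hgraph, SimpleGraph.deleteEdges_adj, chordSet, mem_ofPred_eq, HE, hD.mem_edges,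
      hD.mem_support, SimpleGraph.mem_edgeSet]
    constructor
    · rintro ⟨h, h'⟩
      refine ⟨h, or_iff_not_imp_left.2 fun hE => ?_⟩
      by_contra! hcon
      exact h' ⟨h, hE, hcon⟩
    · rintro ⟨h, h'⟩
      refine ⟨h, fun ⟨_, hE, hcon⟩ => h'.elim hE ?_⟩
      rintro ⟨w, hw, hw'⟩
      exact hw' (hcon w hw)
  ext z
  simp only [drawingH, drawingOn, image_univ, mem_union, mem_iUnion, mem_univ, exists_prop,
    true_and, hH]
  constructor
  · rintro (⟨w, rfl⟩ | ⟨a, b, h, hz⟩)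
    · by_cases hw : w ∈ range D.u
      · obtain ⟨k, rfl⟩ := hw
        exact mem_drawE.2 ⟨_, range_E_subset_HE ⟨k, rfl⟩, (isArc_E k).left_mem⟩
      · have : {z | G.Adj w z}.Nonempty := by
          rw [← ncard_pos, D.off_card w hw]; omega
        obtain ⟨z, hz⟩ := this
        exact mem_drawE.2 ⟨s(w, z), ⟨hz, Or.inr ⟨w, Sym2.mem_mk_left _ _, hw⟩⟩,
          (isArcFromTo_arcSet hz).left_mem⟩
    · exact mem_drawE.2 ⟨_, h, hz⟩
  · intro hz
    obtain ⟨e, he, hz⟩ := mem_drawE.1 hz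
    induction e with | _ a b
    exact Or.inr ⟨a, b, he, hz⟩

theorem mem_union_iff (v : V) : v ∈ Vminus emb C ∪ Vplus emb C ↔ v ∉ range D.u := by
  simp only [Vminus, Vplus, Finset.mem_union, Finset.mem_filter, Finset.mem_univ, true_and,
    hD.mem_support]
  tauto

theorem isFaceOf_iff {f : Set (ℝ × ℝ)} :
    IsFaceOf (drawingH emb C) f ↔ ∃ a, a ∉ D.dH ∧ f = D.face a := by
  rw [hD.drawingH_eq]; rfl

theorem exists_gapFace {f : Set (ℝ × ℝ)} (hf : MinorFaceH emb C f) {i : ℤ}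
    (hi : incEdge emb f (D.E i)) :
    ∃ a v ℓ r, f = D.face a ∧ ℓ ≤ i ∧ i < r ∧ D.GapFace a v ℓ r := by
  obtain ⟨hface, v, ⟨hv, hvf⟩, huniq⟩ := hf
  obtain ⟨a, ha, rfl⟩ := hD.isFaceOf_iff.1 hface
  obtain ⟨ℓ, r, h1, h2, h⟩ := CycleSetup.exists_gapFace ha ((hD.mem_union_iff v).1 hv) hvf
    (fun w hw hwf => huniq w ⟨(hD.mem_union_iff w).2 hw, hwf⟩) hi
  exact ⟨a, v, ℓ, r, rfl, h1, h2, h⟩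

theorem numCEdges_eq {a : ℝ × ℝ} {v : V} {ℓ r : ℤ} (h : D.GapFace a v ℓ r) :
    (numCEdges emb C (D.face a) : ℤ) = r - ℓ := by
  have : (C.edges.toFinset.filter fun e => incEdge emb (D.face a) e) =
      (Finset.Ico ℓ r).image D.E := by
    ext e
    simp only [Finset.mem_filter, List.mem_toFinset, hD.mem_edges, Finset.mem_image,
      Finset.mem_Ico]
    constructor
    · rintro ⟨⟨k, rfl⟩, hk⟩
      obtain ⟨m, h1, h2, h3⟩ := h.edges k hk
      exact ⟨m, ⟨h1, h2⟩, (E_eq_iff.2 h3).symm⟩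
    · rintro ⟨k, ⟨h1, h2⟩, rfl⟩
      exact ⟨⟨k, rfl⟩, h.edge_subset h1 h2⟩
  have hlt := h.lt
  have hlt' := h.lt_add
  rw [numCEdges, this, Finset.card_image_of_injOn, Int.card_Ico]
  · omega
  · intro j hj k hk hjk
    simp only [Finset.coe_Ico, mem_Ico] at hj hk
    exact E_injOn hjk (by omega) (by omega)

end CycleSetup.Describes

end Bridge

section Discharging

variable {V : Type*} [Fintype V] {G : SimpleGraph V} {emb : PlaneEmbedding G} {x : V}
  {C : G.Walk x x} {D : CycleSetup emb}

namespace CycleSetup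

theorem GapFace.exists_mem_window {a : ℝ × ℝ} {v : V} {ℓ r : ℤ} (h : D.GapFace a v ℓ r) {k : ℤ}
    (hk : incEdge emb (D.face a) (D.E k)) : ∃ m, ℓ ≤ m ∧ m < r ∧ D.E k = D.E m := by
  obtain ⟨m, h1, h2, h3⟩ := h.edges k hk
  exact ⟨m, h1, h2, E_eq_iff.2 h3⟩

theorem not_unseparated_of_face_ne {a b : ℝ × ℝ} (ha : a ∉ D.dH) (hb : b ∉ D.dH)
    (hne : D.face a ≠ D.face b) {k : ℤ} (hka : incEdge emb (D.face a) (D.E k))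
    (hkb : incEdge emb (D.face b) (D.E k)) : ¬ Unseparated D.cyc a b :=
  fun h => hne (face_eq_of_side ha hb h hka hkb)

theorem face_eq_of_opposite {a b c : ℝ × ℝ} (ha : a ∉ D.dH) (hb : b ∉ D.dH) (hc : c ∉ D.dH)
    (hab : ¬ Unseparated D.cyc a b) (hac : ¬ Unseparated D.cyc a c) {k : ℤ}
    (hkb : incEdge emb (D.face b) (D.E k)) (hkc : incEdge emb (D.face c) (D.E k)) :
    D.face b = D.face c :=
  face_eq_of_side hb hc (unseparated_of_not_unseparated' (fun h => hb (cyc_subset_dH h))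
    (fun h => hc (cyc_subset_dH h)) (fun h => ha (cyc_subset_dH h)) (fun h => hab h.symm)
    fun h => hac h.symm) hkb hkc

namespace Describes

variable (hD : D.Describes C)
include hD

theorem isMiddleCEdge_iff (hn : 8 ≤ D.n) {a : ℝ × ℝ} {v : V} {ℓ : ℤ}
    (h : D.GapFace a v ℓ (ℓ + 3)) {e : Sym2 V} :
    IsMiddleCEdge emb C (D.face a) e ↔ e = D.E (ℓ + 1) := by
  constructor
  · rintro ⟨he, hinc, hmid⟩
    obtain ⟨k, rfl⟩ := (hD.mem_edges e).1 he
    obtain ⟨m, h1, h2, hm⟩ := h.exists_mem_window hinc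
    rw [hm] at hmid ⊢
    have key : ∀ j, ℓ ≤ j → j < ℓ + 3 → j ≠ m → j = m - 1 ∨ j = m + 1 := by
      intro j hj hj' hjm
      obtain ⟨w, hw, hw'⟩ := hmid (D.E j) ((hD.mem_edges _).2 ⟨j, rfl⟩) (h.edge_subset hj hj')
        fun he => hjm (E_injOn he (by omega) (by omega))
      by_contra! hcon
      rcases mem_E_iff.1 hw with rfl | rfl <;> rcases mem_E_iff.1 hw' with hh | hh <;>
        exact ne_left hn (by omega) (by omega) (by omega) hh
    have h3 := key ℓ
    have h4 := key (ℓ + 2)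
    rw [show m = ℓ + 1 by omega]
  · rintro rfl
    refine ⟨(hD.mem_edges _).2 ⟨_, rfl⟩, h.edge_subset (by omega) (by omega), ?_⟩
    intro e' he' hinc hne
    obtain ⟨k, rfl⟩ := (hD.mem_edges e').1 he'
    obtain ⟨m, h1, h2, hm⟩ := h.exists_mem_window hinc
    rw [hm] at hne ⊢
    obtain rfl | rfl | rfl : m = ℓ ∨ m = ℓ + 1 ∨ m = ℓ + 2 := by omega
    · exact ⟨_, mem_E_iff.2 (Or.inl rfl), mem_E_iff.2 (Or.inr rfl)⟩
    · exact absurd rfl hne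
    · exact ⟨D.u (ℓ + 2), mem_E_iff.2 (Or.inr (by rw [add_assoc]; rfl)), mem_E_iff.2 (Or.inl rfl)⟩

theorem exists_opposite_gapFace {a : ℝ × ℝ} (ha : a ∉ D.dH) {g : Set (ℝ × ℝ)} {j : ℕ}
    (hg : MinorFaceH emb C g) (hj : numCEdges emb C g = j) (hne : D.face a ≠ g) {k : ℤ}
    (hka : incEdge emb (D.face a) (D.E k)) (hkg : incEdge emb g (D.E k)) :
    ∃ b w ℓ, g = D.face b ∧ ℓ ≤ k ∧ k < ℓ + j ∧ D.GapFace b w ℓ (ℓ + j) ∧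
      ¬ Unseparated D.cyc a b := by
  obtain ⟨b, w, ℓ, r, rfl, h1, h2, h⟩ := hD.exists_gapFace hg hkg
  have hr := hD.numCEdges_eq h
  obtain rfl : r = ℓ + j := by omega
  exact ⟨b, w, ℓ, rfl, h1, h2, h, not_unseparated_of_face_ne ha h.notMem hne hka hkg⟩

theorem exists_gapFace_of_numCEdges {f : Set (ℝ × ℝ)} {j : ℕ} (hf : MinorFaceH emb C f)
    (hj : numCEdges emb C f = j) (hj0 : 0 < j) :
    ∃ a v ℓ, f = D.face a ∧ D.GapFace a v ℓ (ℓ + j) := by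
  obtain ⟨e, he⟩ := Finset.card_pos.1 (hj.symm ▸ hj0 : 0 < numCEdges emb C f)
  rw [Finset.mem_filter, List.mem_toFinset, hD.mem_edges] at he
  obtain ⟨⟨k, rfl⟩, hk⟩ := he
  obtain ⟨a, v, ℓ, r, rfl, h1, h2, h⟩ := hD.exists_gapFace hf hk
  have hr := hD.numCEdges_eq h
  obtain rfl : r = ℓ + j := by omega
  exact ⟨a, v, ℓ, rfl, h⟩

variable {a : ℝ × ℝ} {v : V} {ℓ : ℤ}

theorem ne_three_of_middle (hn : 8 ≤ D.n) (hL : D.Longest) (hG : NoTwoSeparator G)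
    (h : D.GapFace a v ℓ (ℓ + 3)) {g : Set (ℝ × ℝ)} (hg : MinorFaceH emb C g)
    (hne : D.face a ≠ g) {e : Sym2 V} (he : IsMiddleCEdge emb C g e)
    (hinc : incEdge emb (D.face a) e) : numCEdges emb C g ≠ 3 := by
  intro h3
  obtain ⟨k, rfl⟩ := (hD.mem_edges e).1 he.1
  obtain ⟨m, h1, h2, hm⟩ := h.exists_mem_window hinc
  rw [hm] at he hinc
  obtain ⟨b, w, ℓ', rfl, h4, h5, hb, hab⟩ :=
    hD.exists_opposite_gapFace h.notMem hg h3 hne hinc he.2.1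
  push_cast at h5 hb
  have := E_injOn ((hD.isMiddleCEdge_iff hn hb).1 he) (by omega) (by omega)
  obtain rfl | rfl | rfl : ℓ' = ℓ - 1 ∨ ℓ' = ℓ ∨ ℓ' = ℓ + 1 := by omega
  · refine GapFace.three_three (ℓ := ℓ - 1) (v := v) hn hL ?_ hb hab
    rwa [show ℓ - 1 + 1 = ℓ by ring, show ℓ - 1 + 4 = ℓ + 3 by ring]
  · exact GapFace.three_three_same hn hG h hb hab
  · refine GapFace.three_three (v := w) hn hL ?_ h fun h => hab h.symm
    rwa [show ℓ + 4 = ℓ + 1 + 3 by ring]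

theorem exists_of_two (hn : 8 ≤ D.n) (hL : D.Longest) (hG : NoTwoSeparator G)
    (h : D.GapFace a v ℓ (ℓ + 3)) {g : Set (ℝ × ℝ)} (hg : MinorFaceH emb C g)
    (h2 : numCEdges emb C g = 2) (hopp : OppositeFaces emb C (D.face a) g) :
    ∃ b w, g = D.face b ∧ ¬ Unseparated D.cyc a b ∧ mEdges emb C (D.face a) g ≤ 1 ∧
      (D.GapFace b w (ℓ - 1) (ℓ + 1) ∨ D.GapFace b w (ℓ + 2) (ℓ + 4)) := by
  obtain ⟨hne, e, he, hea, heg⟩ := hopp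
  obtain ⟨k, rfl⟩ := (hD.mem_edges e).1 he
  obtain ⟨m, h1, h3, hm⟩ := h.exists_mem_window hea
  rw [hm] at hea heg
  obtain ⟨b, w, ℓ', rfl, h4, h5, hb, hab⟩ :=
    hD.exists_opposite_gapFace h.notMem hg h2 hne hea heg
  push_cast at h5 hb
  have hℓ' : ℓ' = ℓ - 1 ∨ ℓ' = ℓ + 2 := by
    by_contra! hcon
    obtain rfl | rfl : ℓ' = ℓ ∨ ℓ' = ℓ + 1 := by omega
    · exact GapFace.three_two_left hn hL hG h hb hab
    · refine GapFace.three_two_right (w := w) hn hL hG h ?_ hab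
      rwa [show ℓ + 3 = ℓ + 1 + 2 by ring]
  refine ⟨b, w, rfl, hab, ?_, ?_⟩
  · have key : ∀ e ∈ C.edges.toFinset.filter fun e => incEdge emb (D.face a) e ∧
        incEdge emb (D.face b) e, e = D.E m := by
      intro e he
      rw [Finset.mem_filter, List.mem_toFinset, hD.mem_edges] at he
      obtain ⟨⟨j, rfl⟩, hja, hjb⟩ := he
      obtain ⟨p, hp, hp', hjp⟩ := h.exists_mem_window hja
      obtain ⟨q, hq, hq', hjq⟩ := hb.exists_mem_window hjb
      have := E_injOn (hjp.symm.trans hjq) (by omega) (by omega)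
      rw [hjp, show p = m by omega]
    exact Finset.card_le_one.2 fun e he e' he' => (key e he).trans (key e' he').symm
  · rcases hℓ' with rfl | rfl
    · exact Or.inl (by rwa [show ℓ + 1 = ℓ - 1 + 2 by ring])
    · exact Or.inr (by rwa [show ℓ + 4 = ℓ + 2 + 2 by ring])

theorem sendWeight_cases (hn : 8 ≤ D.n) (hL : D.Longest) (hG : NoTwoSeparator G)
    (h : D.GapFace a v ℓ (ℓ + 3)) (hf : MinorFaceH emb C (D.face a))
    (h3 : numCEdges emb C (D.face a) = 3) {g : Set (ℝ × ℝ)}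
    (hs : sendWeight emb C (D.face a) g ≠ 0) :
    sendWeight emb C (D.face a) g ≤ 2 / 3 ∧ ∃ b w, g = D.face b ∧ ¬ Unseparated D.cyc a b ∧
      (D.GapFace b w (ℓ - 1) (ℓ + 1) ∨ D.GapFace b w (ℓ + 2) (ℓ + 4)) := by
  have e1 : ¬ MajorFaceH emb C (D.face a) := fun h => h.2 hf
  have e3 : ¬ (MinorFaceH emb C g ∧ numCEdges emb C g = 3 ∧ D.face a ≠ g ∧
      ∃ e : Sym2 V, IsMiddleCEdge emb C g e ∧ incEdge emb (D.face a) e) := by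
    rintro ⟨hg, hg3, hne, e, he, hinc⟩
    exact hD.ne_three_of_middle hn hL hG h hg hne he hinc hg3
  simp only [sendWeight, hf, h3, e1, e3, true_and, false_and, if_false, zero_add, add_zero,
    show ¬ 4 ≤ 3 by norm_num] at hs ⊢
  split_ifs at hs ⊢ with hc
  · obtain ⟨b, w, hb, hab, hm, hcases⟩ := hD.exists_of_two hn hL hG h hc.1 hc.2.1 hc.2.2
    refine ⟨?_, b, w, hb, hab, hcases⟩
    have : (mEdges emb C (D.face a) g : ℚ) ≤ 1 := by exact_mod_cast hm
    linarith
  · exact absurd rfl hs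

theorem sum_sent_le (hn : 8 ≤ D.n) (hL : D.Longest) (hG : NoTwoSeparator G)
    (h : D.GapFace a v ℓ (ℓ + 3)) (hf : MinorFaceH emb C (D.face a))
    (h3 : numCEdges emb C (D.face a) = 3) :
    ∑ᶠ g : Set (ℝ × ℝ), sendWeight emb C (D.face a) g ≤ 2 / 3 := by
  by_cases hex : ∃ g, sendWeight emb C (D.face a) g ≠ 0
  · obtain ⟨g, hg⟩ := hex
    obtain ⟨hle, b, w, rfl, hab, hb⟩ := hD.sendWeight_cases hn hL hG h hf h3 hg
    rwa [finsum_eq_single _ (D.face b)]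
    intro g' hne
    by_contra hg'
    obtain ⟨-, c, w', rfl, hac, hc⟩ := hD.sendWeight_cases hn hL hG h hf h3 hg'
    have hmid : ∀ {b c w w'}, D.GapFace b w (ℓ - 1) (ℓ + 1) → D.GapFace c w' (ℓ + 2) (ℓ + 4) →
        ¬ Unseparated D.cyc a b → ¬ Unseparated D.cyc a c → False := by
      intro b c w w' hb hc hab hac
      refine GapFace.two_three_two (ℓ := ℓ - 1) (a := a) (v := v) (b := b) (c := c) (w := w)
        (w' := w') hn hL ?_ ?_ ?_ hab hac
      · rwa [show ℓ - 1 + 1 = ℓ by ring, show ℓ - 1 + 4 = ℓ + 3 by ring]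
      · rwa [show ℓ - 1 + 2 = ℓ + 1 by ring]
      · rwa [show ℓ - 1 + 3 = ℓ + 2 by ring, show ℓ - 1 + 5 = ℓ + 4 by ring]
    rcases hb with hb | hb <;> rcases hc with hc | hc
    · exact hne (face_eq_of_opposite h.notMem hc.notMem hb.notMem hac hab (k := ℓ)
        (hc.edge_subset (by omega) (by omega)) (hb.edge_subset (by omega) (by omega)))
    · exact hmid hb hc hab hac
    · exact hmid hc hb hac hab
    · exact hne (face_eq_of_opposite h.notMem hc.notMem hb.notMem hac hab (k := ℓ + 2)
        (hc.edge_subset (by omega) (by omega)) (hb.edge_subset (by omega) (by omega)))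
  · push Not at hex
    simp only [hex, finsum_zero]
    norm_num

omit hD in
theorem sendWeight_nonneg (f g : Set (ℝ × ℝ)) : 0 ≤ sendWeight emb C f g := by
  unfold sendWeight
  positivity

theorem finite_support_received (ha : a ∉ D.dH) (h3 : numCEdges emb C (D.face a) = 3) :
    (Function.support fun g => sendWeight emb C g (D.face a)).Finite := by
  refine Finite.subset (s := ⋃ e ∈ C.edges.toFinset, {g | IsFaceOf (drawingH emb C) g ∧
    g ≠ D.face a ∧ incEdge emb (D.face a) e ∧ incEdge emb g e}) ?_ ?_
  · refine Finset.finite_toSet _ |>.biUnion fun e he => Subsingleton.finite ?_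
    rintro g ⟨hg, hga, hea, heg⟩ g' ⟨hg', hga', -, heg'⟩
    obtain ⟨k, rfl⟩ := (hD.mem_edges e).1 (List.mem_toFinset.1 he)
    obtain ⟨b, hb, rfl⟩ := hD.isFaceOf_iff.1 hg
    obtain ⟨c, hc, rfl⟩ := hD.isFaceOf_iff.1 hg'
    exact face_eq_of_opposite ha hb hc (not_unseparated_of_face_ne ha hb hga.symm hea heg)
      (not_unseparated_of_face_ne ha hc hga'.symm hea heg') heg heg'
  · intro g hg
    simp only [mem_iUnion, List.mem_toFinset]
    by_contra! hcon
    refine hg ?_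
    have key : ∀ e ∈ C.edges, IsFaceOf (drawingH emb C) g → g ≠ D.face a →
        incEdge emb g e → ¬ incEdge emb (D.face a) e :=
      fun e he h1 h2 h3 h4 => hcon e he ⟨h1, h2, h4, h3⟩
    have hopp : ¬ (MajorFaceH emb C g ∧ MinorFaceH emb C (D.face a) ∧
        OppositeFaces emb C g (D.face a)) := by
      rintro ⟨hg, -, hne, e, he, h1, h2⟩
      exact key e he hg.1 hne h1 h2
    have hmid : ¬ (MinorFaceH emb C g ∧ MinorFaceH emb C (D.face a) ∧ g ≠ D.face a ∧
        ∃ e : Sym2 V, IsMiddleCEdge emb C (D.face a) e ∧ incEdge emb g e) := by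
      rintro ⟨hg, -, hne, e, he, h1⟩
      exact key e he.1 hg.1 hne h1 he.2.1
    simp [sendWeight, h3, hopp, hmid]

theorem one_le_sum_received (hn : 8 ≤ D.n) (h : D.GapFace a v ℓ (ℓ + 3))
    (hf : MinorFaceH emb C (D.face a)) (h3 : numCEdges emb C (D.face a) = 3) :
    1 ≤ ∑ᶠ g : Set (ℝ × ℝ), sendWeight emb C g (D.face a) := by
  obtain ⟨b, hab, hb, hinc⟩ := exists_opposite (D := D) a (ℓ + 1)
  have hmid := (hD.isMiddleCEdge_iff hn h).2 rfl
  have hne : D.face b ≠ D.face a := by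
    intro heq
    refine hab ((mem_connectedComponentIn_compl_iff.1 ?_).mono cyc_subset_dH)
    change b ∈ D.face a
    exact heq ▸ mem_connectedComponentIn hb
  refine le_trans ?_ (single_le_finsum (D.face b) (hD.finite_support_received h.notMem h3)
    fun g => sendWeight_nonneg g _)
  by_cases hminor : MinorFaceH emb C (D.face b)
  · have hmajor : ¬ MajorFaceH emb C (D.face b) := fun h => h.2 hminor
    have : ∃ e : Sym2 V, IsMiddleCEdge emb C (D.face a) e ∧ incEdge emb (D.face b) e :=
      ⟨_, hmid, hinc⟩
    simp [sendWeight, hminor, hmajor, hf, h3, hne, this]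
  · have hmajor : MajorFaceH emb C (D.face b) := ⟨hD.isFaceOf_iff.2 ⟨b, hb, rfl⟩, hminor⟩
    have hopp : OppositeFaces emb C (D.face b) (D.face a) :=
      ⟨hne, _, hmid.1, hinc, hmid.2.1⟩
    have hm : 1 ≤ mEdges emb C (D.face b) (D.face a) :=
      Finset.card_pos.2 ⟨_, Finset.mem_filter.2
        ⟨List.mem_toFinset.2 hmid.1, hinc, hmid.2.1⟩⟩
    simpa [sendWeight, hminor, hmajor, hf, hopp] using hm

end Describes

end CycleSetup

end Discharging

end

/-- After discharging by rules R1–R5, every minor 3-face of `H` has weight `≥ 10/3`. -/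
theorem stmt9_minor_3face
    {V : Type*} [Fintype V] {G : SimpleGraph V}
    (hn : 11 ≤ Fintype.card V) (h4 : EssentiallyFourConnected G)
    (emb : PlaneEmbedding G) {x : V} (C : G.Walk x x)
    (hC : IsLongestIsolatingCycle G C) (hc : 8 ≤ C.length)
    (hVm : (Vminus emb C).Nonempty) (hVp : (Vplus emb C).Nonempty) :
    ∀ f : Set (ℝ × ℝ), MinorFaceH emb C f → numCEdges emb C f = 3 →
      (10 : ℚ) / 3 ≤ wFace emb C f := by
  intro f hf h3
  obtain ⟨D, hD⟩ := exists_describes hC.1 hC.2.1 hVm hVp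
  have h8 : 8 ≤ D.n := hD.length_eq ▸ hc
  obtain ⟨a, v, ℓ, rfl, h⟩ := hD.exists_gapFace_of_numCEdges hf h3 (by norm_num)
  have hsent := hD.sum_sent_le h8 (hD.longest hC) (noTwoSeparator_of_threeConnected h4.1) h hf h3
  have hreceived := hD.one_le_sum_received h8 h hf h3
  rw [wFace, h3]
  push_cast
  linarith

end
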